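/- Let k ≥ 3 and ε ∈ (0,1) be fixed. There is a constant r₀ = r₀(k,ε) such that for any function r = r(n) satisfying r ≥ r₀ and r^{k−1} ln r = o(n^{k−1}), one has P(χ(H(n,k,p)) ≤ r) → 1 as n → ∞, where p = (1−ε) · r^{k−1} ln r · n/C(n,k). -/

import Mathlib

open Finset Filter

open scoped Classical

namespace HG

/-- A finset `e` is monochromatic under the coloring `c`. -/
def Monochromatic {V α : Type*} (c : V → α) (e : Finset V) : Prop :=
  ∀ v ∈ e, ∀ w ∈ e, c v = c w

/-- The hypergraph with edge set `E` admits a proper coloring with `r` colors. -/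
def RColorable {V : Type*} (r : ℕ) (E : Finset (Finset V)) : Prop :=
  ∃ c : V → Fin r, ∀ e ∈ E, ¬ Monochromatic c e

/-- The hypergraph with edge set `E` is `r`-choosable: for every assignment of
color lists of size `r` there is a proper coloring from the lists. -/
def RChoosable {V : Type*} (r : ℕ) (E : Finset (Finset V)) : Prop :=
  ∀ L : V → Finset ℕ, (∀ v, (L v).card = r) →
    ∃ c : V → ℕ, (∀ v, c v ∈ L v) ∧ ∀ e ∈ E, ¬ Monochromatic c e

/-- Probability that the binomial random hypergraph `H(n,k,p)` (each of the
`C(n,k)` possible `k`-element edges present independently with probability `p`)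
satisfies the property `P` of its edge set. -/
noncomputable def hyperProb (n k : ℕ) (p : ℝ)
    (P : Finset (Finset (Fin n)) → Prop) : ℝ :=
  ∑ E ∈ ((Finset.univ : Finset (Fin n)).powersetCard k).powerset,
    if P E then
      p ^ E.card *
        (1 - p) ^ (((Finset.univ : Finset (Fin n)).powersetCard k).card - E.card)
    else 0

/-- Maximum vertex degree of the hypergraph with edge set `E`. -/
def maxDegree {V : Type*} [DecidableEq V] (E : Finset (Finset V)) : ℕ :=
  (E.biUnion id).sup fun v => (E.filter fun e => v ∈ e).card

/-- Three distinct edges forming a 3-cycle (triangle). -/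
def IsTriangle {V : Type*} [DecidableEq V] (e f h : Finset V) : Prop :=
  e ≠ f ∧ e ≠ h ∧ f ≠ h ∧ ((e ∩ f) \ h).Nonempty ∧ ((e ∩ h) \ f).Nonempty ∧
    ((f ∩ h) \ e).Nonempty

/-- A hypergraph is 2-simple if any two distinct edges share at most 2 vertices. -/
def TwoSimple {V : Type*} [DecidableEq V] (E : Finset (Finset V)) : Prop :=
  ∀ e ∈ E, ∀ f ∈ E, e ≠ f → (e ∩ f).card ≤ 2

/-- The number of 3-cycles of the hypergraph `E` containing the edge `e`. -/
noncomputable def triCount {V : Type*} [DecidableEq V]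
    (E : Finset (Finset V)) (e : Finset V) : ℕ :=
  ((E.powersetCard 2).filter fun s =>
    ∃ f ∈ s, ∃ h ∈ s, f ≠ h ∧ IsTriangle e f h).card

/-- The function `φ(k) = 4⌊√(ln k / ln (2 ln k))⌋⁻¹`. -/
noncomputable def phi (k : ℕ) : ℝ :=
  4 * ((⌊Real.sqrt (Real.log k / Real.log (2 * Real.log k))⌋₊ : ℝ))⁻¹

end HG

namespace HG

section Expectation

variable {α : Type*}

/-- Expectation of `f` evaluated at the random subset of `G` that contains each element
independently with probability `p`. -/
noncomputable def subsetExp (p : ℝ) (G : Finset α) (f : Finset α → ℝ) : ℝ :=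
  ∑ A ∈ G.powerset, p ^ A.card * (1 - p) ^ (G.card - A.card) * f A

/-- Indicator of a proposition as a real number. -/
noncomputable def ind (P : Prop) : ℝ := if P then 1 else 0

lemma ind_nonneg (P : Prop) : 0 ≤ ind P := by unfold ind; split_ifs <;> norm_num

lemma ind_le_one (P : Prop) : ind P ≤ 1 := by unfold ind; split_ifs <;> norm_num

lemma ind_true {P : Prop} (h : P) : ind P = 1 := if_pos h

lemma ind_false {P : Prop} (h : ¬ P) : ind P = 0 := if_neg h

lemma hyperProb_eq_subsetExp (n k : ℕ) (p : ℝ) (P : Finset (Finset (Fin n)) → Prop) :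
    hyperProb n k p P =
      subsetExp p ((Finset.univ : Finset (Fin n)).powersetCard k) (fun E => ind (P E)) := by
  unfold hyperProb subsetExp
  refine Finset.sum_congr rfl fun E _ => ?_
  by_cases h : P E <;> simp [h, ind]

lemma subsetExp_mul_left (p : ℝ) (G : Finset α) (a : ℝ) (f : Finset α → ℝ) :
    subsetExp p G (fun A => a * f A) = a * subsetExp p G f := by
  unfold subsetExp
  rw [Finset.mul_sum]
  exact Finset.sum_congr rfl fun A _ => by ring

lemma subsetExp_mul_right (p : ℝ) (G : Finset α) (a : ℝ) (f : Finset α → ℝ) :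
    subsetExp p G (fun A => f A * a) = subsetExp p G f * a := by
  rw [mul_comm, ← subsetExp_mul_left]
  simp only [mul_comm]

lemma subsetExp_add (p : ℝ) (G : Finset α) (f g : Finset α → ℝ) :
    subsetExp p G (fun A => f A + g A) = subsetExp p G f + subsetExp p G g := by
  unfold subsetExp
  rw [← Finset.sum_add_distrib]
  exact Finset.sum_congr rfl fun A _ => by ring

lemma subsetExp_sum {ι : Type*} (p : ℝ) (G : Finset α) (s : Finset ι)
    (f : ι → Finset α → ℝ) :
    subsetExp p G (fun A => ∑ i ∈ s, f i A) = ∑ i ∈ s, subsetExp p G (f i) := by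
  unfold subsetExp
  rw [Finset.sum_comm]
  exact Finset.sum_congr rfl fun A _ => by rw [Finset.mul_sum]

lemma weight_nonneg {p : ℝ} (h0 : 0 ≤ p) (h1 : p ≤ 1) (a b : ℕ) :
    0 ≤ p ^ a * (1 - p) ^ b :=
  mul_nonneg (pow_nonneg h0 _) (pow_nonneg (sub_nonneg.2 h1) _)

lemma subsetExp_mono {p : ℝ} (h0 : 0 ≤ p) (h1 : p ≤ 1) {G : Finset α} {f g : Finset α → ℝ}
    (h : ∀ A ⊆ G, f A ≤ g A) : subsetExp p G f ≤ subsetExp p G g :=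
  Finset.sum_le_sum fun A hA =>
    mul_le_mul_of_nonneg_left (h A (Finset.mem_powerset.1 hA)) (weight_nonneg h0 h1 _ _)

/-- The second moment method: the Cauchy–Schwarz inequality for `subsetExp`. -/
lemma subsetExp_sq_le {p : ℝ} (h0 : 0 ≤ p) (h1 : p ≤ 1) (G : Finset α)
    (X : Finset α → ℝ) (P : Finset α → Prop) (hP : ∀ A ⊆ G, ¬ P A → X A = 0) :
    subsetExp p G X ^ 2 ≤
      subsetExp p G (fun A => ind (P A)) * subsetExp p G (fun A => X A ^ 2) := by
  unfold subsetExp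
  refine Finset.sum_sq_le_sum_mul_sum_of_sq_le_mul _ ?_ ?_ ?_
  · exact fun A _ => mul_nonneg (weight_nonneg h0 h1 _ _) (ind_nonneg _)
  · exact fun A _ => mul_nonneg (weight_nonneg h0 h1 _ _) (sq_nonneg _)
  · intro A hA
    by_cases h : P A
    · simp only [ind_true h]; apply le_of_eq; ring
    · simp only [hP A (Finset.mem_powerset.1 hA) h, ind_false h]; apply le_of_eq; ring

variable [DecidableEq α]

lemma subsetExp_prod (p : ℝ) (G : Finset α) (x : α → ℝ) :
    subsetExp p G (fun A => ∏ e ∈ A, x e) = ∏ e ∈ G, (1 - p + p * x e) := by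
  simp_rw [add_comm (1 - p), Finset.prod_add]
  refine Finset.sum_congr rfl fun A hA => ?_
  rw [Finset.prod_mul_distrib, Finset.prod_const, Finset.prod_const,
    Finset.card_sdiff_of_subset (Finset.mem_powerset.1 hA)]
  ring

lemma subsetExp_const (p : ℝ) (G : Finset α) (a : ℝ) : subsetExp p G (fun _ => a) = a := by
  have h := subsetExp_prod p G (fun _ => (1 : ℝ))
  have h2 := subsetExp_mul_left p G a (fun _ => (1 : ℝ))
  simp only [Finset.prod_const_one, mul_one, sub_add_cancel] at h h2
  rw [h2, h, mul_one]

lemma subsetExp_disjoint (p : ℝ) {F G : Finset α} (hF : F ⊆ G) :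
    subsetExp p G (fun A => ind (Disjoint F A)) = (1 - p) ^ F.card := by
  have h := subsetExp_prod p G (fun e => if e ∈ F then 0 else 1)
  have h1 : ∀ A : Finset α, ∏ e ∈ A, (if e ∈ F then (0 : ℝ) else 1) = ind (Disjoint F A) := by
    intro A
    by_cases hd : Disjoint F A
    · rw [ind_true hd]
      exact Finset.prod_eq_one fun e he => if_neg fun hf => Finset.disjoint_left.1 hd hf he
    · rw [ind_false hd]
      obtain ⟨e, hf, ha⟩ := Finset.not_disjoint_iff.1 hd
      exact Finset.prod_eq_zero ha (if_pos hf)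
  simp only [h1] at h
  rw [h, ← Finset.prod_sdiff hF, Finset.prod_eq_one, one_mul, Finset.prod_congr rfl
    (g := fun _ => 1 - p), Finset.prod_const]
  · intro e he; simp [he]
  · intro e he; simp [(Finset.mem_sdiff.1 he).2]

lemma subsetExp_union (p : ℝ) {G H : Finset α} (h : Disjoint G H) (f : Finset α → ℝ) :
    subsetExp p (G ∪ H) f = subsetExp p G (fun A => subsetExp p H (fun B => f (A ∪ B))) := by
  unfold subsetExp
  simp_rw [Finset.mul_sum]
  rw [← Finset.sum_product']
  symm
  refine Finset.sum_bij' (fun x _ => x.1 ∪ x.2) (fun A _ => (A ∩ G, A ∩ H)) ?_ ?_ ?_ ?_ ?_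
  · rintro ⟨A, B⟩ hx
    simp only [Finset.mem_product, Finset.mem_powerset] at hx ⊢
    exact Finset.union_subset_union hx.1 hx.2
  · intro A hA
    simp
  · rintro ⟨A, B⟩ hx
    simp only [Finset.mem_product, Finset.mem_powerset] at hx
    have h1 : Disjoint A H := h.mono_left hx.1
    have h2 : Disjoint B G := (h.mono_right hx.2).symm
    simp only [Finset.union_inter_distrib_right, Finset.disjoint_iff_inter_eq_empty.1 h1,
      Finset.disjoint_iff_inter_eq_empty.1 h2, Finset.inter_eq_left.2 hx.1,
      Finset.inter_eq_left.2 hx.2, Finset.union_empty, Finset.empty_union]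
  · intro A hA
    rw [← Finset.inter_union_distrib_left]
    exact Finset.inter_eq_left.2 (Finset.mem_powerset.1 hA)
  · rintro ⟨A, B⟩ hx
    simp only [Finset.mem_product, Finset.mem_powerset] at hx
    have hd : Disjoint A B := (h.mono_left hx.1).mono_right hx.2
    have hA := Finset.card_le_card hx.1
    have hB := Finset.card_le_card hx.2
    have e : G.card + H.card - (A.card + B.card) = (G.card - A.card) + (H.card - B.card) := by
      omega
    simp only [Finset.card_union_of_disjoint h, Finset.card_union_of_disjoint hd, e, pow_add]
    ring

lemma exp_le_cosh_add {t x : ℝ} (hx : |x| ≤ 1) :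
    Real.exp (t * x) ≤ Real.cosh t + x * Real.sinh t := by
  obtain ⟨h1, h2⟩ := abs_le.1 hx
  have h := convexOn_exp.2 (Set.mem_univ t) (Set.mem_univ (-t))
    (show 0 ≤ (1 + x) / 2 by linarith) (show 0 ≤ (1 - x) / 2 by linarith) (by ring)
  simp only [smul_eq_mul] at h
  rw [Real.cosh_eq, Real.sinh_eq]
  calc Real.exp (t * x) = Real.exp ((1 + x) / 2 * t + (1 - x) / 2 * -t) := by ring_nf
    _ ≤ _ := h
    _ = _ := by ring

/-- Exponential moment of a centred function whose oscillation is at most one. -/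
lemma subsetExp_exp_le {p : ℝ} (h0 : 0 ≤ p) (h1 : p ≤ 1) (G : Finset α) (f : Finset α → ℝ)
    (hf : ∀ A ⊆ G, ∀ B ⊆ G, f A ≤ f B + 1) (t : ℝ) :
    subsetExp p G (fun A => Real.exp (t * (f A - subsetExp p G f))) ≤ Real.exp (t ^ 2 / 2) := by
  set m := subsetExp p G f with hm
  have hb : ∀ A ⊆ G, |f A - m| ≤ 1 := by
    intro A hA
    have u : m ≤ f A + 1 := by
      rw [← subsetExp_const p G (f A + 1)]
      exact subsetExp_mono h0 h1 fun B hB => hf B hB A hA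
    have l : f A - 1 ≤ m := by
      rw [← subsetExp_const p G (f A - 1)]
      exact subsetExp_mono h0 h1 fun B hB => by linarith [hf A hA B hB]
    exact abs_le.2 ⟨by linarith, by linarith⟩
  calc _ ≤ subsetExp p G (fun A => (Real.cosh t - m * Real.sinh t) + f A * Real.sinh t) :=
        subsetExp_mono h0 h1 fun A hA => (exp_le_cosh_add (hb A hA)).trans (le_of_eq (by ring))
    _ = Real.cosh t := by
        rw [subsetExp_add, subsetExp_const, subsetExp_mul_right]; ring
    _ ≤ _ := Real.cosh_le_exp_half_sq t

/-- The exponential moment bound behind McDiarmid's inequality. -/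
lemma subsetExp_exp_biUnion_le {ι : Type*} [DecidableEq ι] {p : ℝ} (h0 : 0 ≤ p) (h1 : p ≤ 1)
    (s : Finset ι) (G : ι → Finset α)
    (hd : ∀ i ∈ s, ∀ j ∈ s, i ≠ j → Disjoint (G i) (G j)) (f : Finset α → ℝ)
    (hf : ∀ i ∈ s, ∀ A, ∀ B ⊆ G i, ∀ C ⊆ G i, f (A ∪ B) ≤ f (A ∪ C) + 1) (t : ℝ) :
    subsetExp p (s.biUnion G)
      (fun A => Real.exp (t * (f A - subsetExp p (s.biUnion G) f))) ≤
      Real.exp (s.card * (t ^ 2 / 2)) := by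
  induction s using Finset.induction_on generalizing f with
  | empty => simp [subsetExp]
  | insert i s hi ih =>
    have hdis : Disjoint (s.biUnion G) (G i) := by
      rw [Finset.disjoint_biUnion_left]
      exact fun j hj => hd j (Finset.mem_insert_of_mem hj) i (Finset.mem_insert_self _ _)
        fun h => hi (h ▸ hj)
    rw [Finset.biUnion_insert, Finset.union_comm, Finset.card_insert_of_notMem hi]
    set g : Finset α → ℝ := fun A => subsetExp p (G i) (fun B => f (A ∪ B)) with hg
    have hm : subsetExp p (s.biUnion G ∪ G i) f = subsetExp p (s.biUnion G) g :=
      subsetExp_union p hdis f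
    rw [hm, subsetExp_union p hdis]
    set m := subsetExp p (s.biUnion G) g with hmdef
    have hgl : ∀ j ∈ s, ∀ A, ∀ B ⊆ G j, ∀ C ⊆ G j, g (A ∪ B) ≤ g (A ∪ C) + 1 := by
      intro j hj A B hB C hC
      have : g (A ∪ C) + 1 = subsetExp p (G i) (fun D => f (A ∪ C ∪ D) + 1) := by
        rw [subsetExp_add, subsetExp_const]
      rw [this]
      refine subsetExp_mono h0 h1 fun D _ => ?_
      rw [Finset.union_right_comm, Finset.union_right_comm A C]
      exact hf j (Finset.mem_insert_of_mem hj) _ B hB C hC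
    have ih' := ih (fun a ha b hb => hd a (Finset.mem_insert_of_mem ha) b
      (Finset.mem_insert_of_mem hb)) g hgl
    calc _ ≤ subsetExp p (s.biUnion G)
          (fun A => Real.exp (t * (g A - m)) * Real.exp (t ^ 2 / 2)) := by
          refine subsetExp_mono h0 h1 fun A _ => ?_
          have e : ∀ B, Real.exp (t * (f (A ∪ B) - m)) =
              Real.exp (t * (g A - m)) * Real.exp (t * (f (A ∪ B) - g A)) := by
            intro B; rw [← Real.exp_add]; ring_nf
          simp_rw [e]
          rw [subsetExp_mul_left]
          refine mul_le_mul_of_nonneg_left ?_ (Real.exp_pos _).le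
          exact subsetExp_exp_le h0 h1 (G i) (fun B => f (A ∪ B))
            (fun B hB C hC => hf i (Finset.mem_insert_self _ _) A B hB C hC) t
      _ ≤ Real.exp (s.card * (t ^ 2 / 2)) * Real.exp (t ^ 2 / 2) := by
          rw [subsetExp_mul_right]
          exact mul_le_mul_of_nonneg_right ih' (Real.exp_pos _).le
      _ = _ := by
          rw [← Real.exp_add]; push_cast; ring_nf

/-- A function with bounded differences cannot be both at most `a` and at least `b` with
substantial probability. -/
lemma subsetExp_two_sided {ι : Type*} [DecidableEq ι] {p : ℝ} (h0 : 0 ≤ p) (h1 : p ≤ 1)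
    (s : Finset ι) (hs : 0 < s.card) (G : ι → Finset α)
    (hd : ∀ i ∈ s, ∀ j ∈ s, i ≠ j → Disjoint (G i) (G j)) (f : Finset α → ℝ)
    (hf : ∀ i ∈ s, ∀ A, ∀ B ⊆ G i, ∀ C ⊆ G i, f (A ∪ B) ≤ f (A ∪ C) + 1)
    {a b : ℝ} (hab : a ≤ b) :
    subsetExp p (s.biUnion G) (fun A => ind (f A ≤ a)) *
      subsetExp p (s.biUnion G) (fun A => ind (b ≤ f A)) ≤
      Real.exp (-((b - a) ^ 2 / (4 * s.card))) := by
  set m := subsetExp p (s.biUnion G) f with hm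
  have hc : (0 : ℝ) < s.card := by exact_mod_cast hs
  set t := (b - a) / (2 * s.card) with ht
  have ht0 : 0 ≤ t := by rw [ht]; apply div_nonneg <;> linarith
  have hl : subsetExp p (s.biUnion G) (fun A => ind (f A ≤ a)) ≤
      Real.exp (t * (a - m)) * Real.exp (s.card * ((-t) ^ 2 / 2)) := by
    calc _ ≤ subsetExp p (s.biUnion G)
          (fun A => Real.exp (t * (a - m)) * Real.exp (-t * (f A - m))) := by
          refine subsetExp_mono h0 h1 fun A _ => ?_
          by_cases h : f A ≤ a
          · rw [ind_true h, ← Real.exp_add]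
            exact Real.one_le_exp (by nlinarith)
          · rw [ind_false h]; positivity
      _ ≤ _ := by
          rw [subsetExp_mul_left]
          exact mul_le_mul_of_nonneg_left
            (subsetExp_exp_biUnion_le h0 h1 s G hd f hf (-t)) (Real.exp_pos _).le
  have hu : subsetExp p (s.biUnion G) (fun A => ind (b ≤ f A)) ≤
      Real.exp (t * (m - b)) * Real.exp (s.card * (t ^ 2 / 2)) := by
    calc _ ≤ subsetExp p (s.biUnion G)
          (fun A => Real.exp (t * (m - b)) * Real.exp (t * (f A - m))) := by
          refine subsetExp_mono h0 h1 fun A _ => ?_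
          by_cases h : b ≤ f A
          · rw [ind_true h, ← Real.exp_add]
            exact Real.one_le_exp (by nlinarith)
          · rw [ind_false h]; positivity
      _ ≤ _ := by
          rw [subsetExp_mul_left]
          exact mul_le_mul_of_nonneg_left
            (subsetExp_exp_biUnion_le h0 h1 s G hd f hf t) (Real.exp_pos _).le
  have hnn : 0 ≤ subsetExp p (s.biUnion G) (fun A => ind (b ≤ f A)) := by
    rw [← subsetExp_const p (s.biUnion G) 0]
    exact subsetExp_mono h0 h1 fun A _ => ind_nonneg _
  refine (mul_le_mul hl hu hnn (by positivity)).trans (le_of_eq ?_)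
  simp only [← Real.exp_add]
  congr 1
  rw [ht]
  field_simp
  ring

end Expectation

section Colouring

variable {V : Type*}

/-- The edges of `E` inside `S` can be properly coloured with the colours `0, …, r - 1`. -/
def ColorableOn (E : Finset (Finset V)) (S : Finset V) (r : ℕ) : Prop :=
  ∃ c : V → ℕ, (∀ v ∈ S, c v < r) ∧ ∀ e ∈ E, e ⊆ S → ¬ Monochromatic c e

lemma ColorableOn.rColorable [Fintype V] {E : Finset (Finset V)} {r : ℕ}
    (h : ColorableOn E Finset.univ r) : RColorable r E := by
  obtain ⟨c, hc, hE⟩ := h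
  refine ⟨fun v => ⟨c v, hc v (Finset.mem_univ v)⟩, fun e he hm => ?_⟩
  exact hE e he (Finset.subset_univ e) fun v hv w hw => by simpa using hm v hv w hw

lemma ColorableOn.mono {E : Finset (Finset V)} {S : Finset V} {r r' : ℕ}
    (h : ColorableOn E S r) (hr : r ≤ r') : ColorableOn E S r' := by
  obtain ⟨c, hc, hE⟩ := h
  exact ⟨c, fun v hv => (hc v hv).trans_le hr, hE⟩

lemma colorableOn_one_of_independent {E : Finset (Finset V)} {I : Finset V}
    (hI : ∀ e ∈ E, ¬ e ⊆ I) : ColorableOn E I 1 :=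
  ⟨fun _ => 0, fun _ _ => one_pos, fun e he hs => absurd hs (hI e he)⟩

variable [DecidableEq V]

/-- The edges of `E` contained in `U`. -/
def edgesIn (E : Finset (Finset V)) (U : Finset V) : Finset (Finset V) := E.filter (· ⊆ U)

lemma mem_edgesIn {E : Finset (Finset V)} {U e : Finset V} :
    e ∈ edgesIn E U ↔ e ∈ E ∧ e ⊆ U := Finset.mem_filter

lemma ColorableOn.union {E : Finset (Finset V)} (hE : ∀ e ∈ E, e.Nonempty) {S T : Finset V}
    {a b : ℕ} (hS : ColorableOn E S a) (hT : ColorableOn E T b) :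
    ColorableOn E (S ∪ T) (a + b) := by
  obtain ⟨c, hc, hcE⟩ := hS
  obtain ⟨d, hd, hdE⟩ := hT
  refine ⟨fun v => if v ∈ S then c v else a + d v, fun v hv => ?_, fun e he hsub hm => ?_⟩
  · by_cases h : v ∈ S
    · simp only [h, if_true]; have := hc v h; omega
    · have := hd v ((Finset.mem_union.1 hv).resolve_left h)
      simp only [h, if_false]; omega
  · obtain ⟨v, hv⟩ := hE e he
    by_cases h : v ∈ S
    · have hs : e ⊆ S := by
        intro w hw
        by_contra hwS
        have := hm v hv w hw
        simp only [h, hwS, if_true, if_false] at this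
        have := hc v h
        omega
      refine hcE e he hs fun x hx y hy => ?_
      simpa [hs hx, hs hy] using hm x hx y hy
    · have hs : ∀ w ∈ e, w ∉ S := by
        intro w hw hwS
        have := hm v hv w hw
        simp only [h, hwS, if_true, if_false] at this
        have := hc w hwS
        omega
      refine hdE e he (fun w hw => (Finset.mem_union.1 (hsub hw)).resolve_left (hs w hw))
        fun x hx y hy => ?_
      simpa [hs x hx, hs y hy] using hm x hx y hy

/-- Greedy colouring along a degenerate ordering. -/
lemma colorableOn_of_sparse {E : Finset (Finset V)} {k t : ℕ} (hk : 2 ≤ k)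
    (hE : ∀ e ∈ E, e.card = k) (U : Finset V)
    (h : ∀ W ⊆ U, W.Nonempty → k * (edgesIn E W).card < t * W.card) :
    ColorableOn E U t := by
  induction U using Finset.strongInduction with
  | H U ih =>
    rcases U.eq_empty_or_nonempty with rfl | hU
    · refine ⟨fun _ => 0, by simp, fun e he hs => ?_⟩
      have := hE e he
      rw [Finset.subset_empty.1 hs, Finset.card_empty] at this
      omega
    have hdeg : ∑ v ∈ U, ((edgesIn E U).filter (v ∈ ·)).card = k * (edgesIn E U).card := by
      simp_rw [Finset.card_filter]
      rw [Finset.sum_comm, mul_comm, ← smul_eq_mul, ← Finset.sum_const]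
      refine Finset.sum_congr rfl fun e he => ?_
      obtain ⟨he, hs⟩ := mem_edgesIn.1 he
      rw [← Finset.card_filter, Finset.filter_mem_eq_inter, Finset.inter_eq_right.2 hs, hE e he]
    obtain ⟨v, hvU, hv⟩ : ∃ v ∈ U, ((edgesIn E U).filter (v ∈ ·)).card < t := by
      by_contra! hcon
      have := Finset.sum_le_sum hcon
      rw [hdeg, Finset.sum_const, smul_eq_mul, mul_comm] at this
      exact absurd (h U subset_rfl hU) (by omega)
    obtain ⟨c, hc, hcE⟩ := ih (U.erase v) (Finset.erase_ssubset hvU)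
      fun W hW => h W (hW.trans (Finset.erase_subset v U))
    have hother : ∀ e ∈ (edgesIn E U).filter (v ∈ ·), ∃ w ∈ e, w ≠ v := by
      intro e he
      have := hE e (mem_edgesIn.1 (Finset.mem_filter.1 he).1).1
      exact Finset.exists_mem_ne (by omega) v
    have : Nonempty V := ⟨v⟩
    choose! w hw hwv using hother
    obtain ⟨i, hit, hi⟩ : ∃ i ∈ Finset.range t,
        i ∉ ((edgesIn E U).filter (v ∈ ·)).image (fun e => c (w e)) := by
      apply Finset.exists_mem_notMem_of_card_lt_card
      rw [Finset.card_range]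
      exact Finset.card_image_le.trans_lt hv
    refine ⟨Function.update c v i, fun x hx => ?_, fun e he hs hm => ?_⟩
    · by_cases hxv : x = v
      · subst hxv; simpa using hit
      · rw [Function.update_of_ne hxv]
        exact hc x (Finset.mem_erase.2 ⟨hxv, hx⟩)
    · by_cases hve : v ∈ e
      · have hf : e ∈ (edgesIn E U).filter (v ∈ ·) :=
          Finset.mem_filter.2 ⟨mem_edgesIn.2 ⟨he, hs⟩, hve⟩
        have := hm v hve (w e) (hw e hf)
        rw [Function.update_self, Function.update_of_ne (hwv e hf)] at this
        exact hi (Finset.mem_image.2 ⟨e, hf, this.symm⟩)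
      · refine hcE e he (Finset.subset_erase.2 ⟨hs, hve⟩) fun x hx y hy => ?_
        have := hm x hx y hy
        rwa [Function.update_of_ne (ne_of_mem_of_not_mem hx hve),
          Function.update_of_ne (ne_of_mem_of_not_mem hy hve)] at this

/-- Repeatedly extracting independent sets of size at least `a`. -/
lemma colorableOn_of_extraction {E : Finset (Finset V)} (hE : ∀ e ∈ E, e.Nonempty) {a t : ℕ}
    (ha : 0 < a) (m : ℕ) (S : Finset V) (hm : S.card ≤ m * a)
    (h : ∀ U ⊆ S, ColorableOn E U t ∨ ∃ I ⊆ U, a ≤ I.card ∧ ∀ e ∈ E, ¬ e ⊆ I) :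
    ColorableOn E S (m + t) := by
  induction m generalizing S with
  | zero =>
    rcases h S subset_rfl with h | ⟨I, hI, hc, _⟩
    · simpa using h
    · have := Finset.card_le_card hI
      omega
  | succ m ih =>
    rcases h S subset_rfl with hS | ⟨I, hI, hc, hind⟩
    · exact hS.mono (by omega)
    · have hrest := ih (S \ I)
        (by rw [Finset.card_sdiff_of_subset hI]; rw [add_mul, one_mul] at hm; omega)
        fun U hU => h U (hU.trans Finset.sdiff_subset)
      have := (colorableOn_one_of_independent hind).union hE hrest
      rw [Finset.union_sdiff_of_subset hI] at this
      exact this.mono (by omega)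

lemma choose_mul_pow_le {x n : ℕ} (k : ℕ) (h : x ≤ n) :
    x.choose k * n ^ k ≤ n.choose k * x ^ k := by
  have key : x.descFactorial k * n ^ k ≤ n.descFactorial k * x ^ k := by
    induction k with
    | zero => simp
    | succ k ih =>
      rw [Nat.descFactorial_succ, Nat.descFactorial_succ, pow_succ, pow_succ]
      have h2 : (x - k) * n ≤ (n - k) * x := by
        rw [Nat.sub_mul, Nat.sub_mul, mul_comm n x]
        exact Nat.sub_le_sub_left (Nat.mul_le_mul_left k h) _
      calc _ = ((x - k) * n) * (x.descFactorial k * n ^ k) := by ring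
        _ ≤ ((n - k) * x) * (n.descFactorial k * x ^ k) := Nat.mul_le_mul h2 ih
        _ = _ := by ring
  rw [Nat.descFactorial_eq_factorial_mul_choose, Nat.descFactorial_eq_factorial_mul_choose,
    mul_assoc, mul_assoc] at key
  exact Nat.le_of_mul_le_mul_left key (Nat.factorial_pos k)

/-- A sparse set of vertices contains a large independent set. -/
lemma exists_independent {E : Finset (Finset V)} {k a : ℕ} (hk : 1 ≤ k)
    (hE : ∀ e ∈ E, e.card = k) (U : Finset V) (hU : 2 * a ≤ U.card)
    (h : (edgesIn E U).card * (2 * a) ^ k ≤ a * U.card ^ k) :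
    ∃ I ⊆ U, a ≤ I.card ∧ ∀ e ∈ E, ¬ e ⊆ I := by
  have hcount : ∀ e ∈ edgesIn E U, (((U.powersetCard (2 * a)).filter (e ⊆ ·)).card) * U.card ^ k ≤
      (U.card.choose (2 * a)) * (2 * a) ^ k := by
    intro e he
    obtain ⟨he, hs⟩ := mem_edgesIn.1 he
    by_cases hka : k ≤ 2 * a
    · have hcard : ((U.powersetCard (2 * a)).filter (e ⊆ ·)).card ≤
          (U.card - k).choose (2 * a - k) := by
        rw [← hE e he, ← Finset.card_sdiff_of_subset hs, ← Finset.card_powersetCard]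
        refine Finset.card_le_card_of_injOn (· \ e) ?_ ?_
        · intro A hA
          simp only [Finset.coe_filter, Finset.mem_powersetCard, Set.mem_ofPred_eq] at hA
          simp only [Finset.mem_coe, Finset.mem_powersetCard]
          exact ⟨Finset.sdiff_subset_sdiff hA.1.1 subset_rfl, by
            rw [Finset.card_sdiff_of_subset hA.2, hA.1.2]⟩
        · intro A hA B hB hAB
          simp only [Finset.coe_filter, Set.mem_ofPred_eq] at hA hB
          rw [← Finset.sdiff_union_of_subset hA.2, ← Finset.sdiff_union_of_subset hB.2]
          exact congrArg (· ∪ e) hAB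
      have h1 := Nat.choose_mul (n := U.card) hka
      have h2 := choose_mul_pow_le k hU
      have hpos : 0 < U.card.choose k := Nat.choose_pos (hka.trans hU)
      refine (Nat.mul_le_mul_right _ hcard).trans ?_
      refine Nat.le_of_mul_le_mul_left ?_ hpos
      calc _ = (U.card.choose k * (U.card - k).choose (2 * a - k)) * U.card ^ k := by ring
        _ = U.card.choose (2 * a) * ((2 * a).choose k * U.card ^ k) := by rw [← h1]; ring
        _ ≤ U.card.choose (2 * a) * (U.card.choose k * (2 * a) ^ k) := Nat.mul_le_mul_left _ h2
        _ = _ := by ring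
    · rw [Finset.card_eq_zero.2, zero_mul]
      · exact Nat.zero_le _
      · refine Finset.filter_eq_empty_iff.2 fun A hA hs => ?_
        have := Finset.card_le_card hs
        rw [hE e he, (Finset.mem_powersetCard.1 hA).2] at this
        omega
  rcases Nat.eq_zero_or_pos U.card with h0 | hUpos
  · exact ⟨∅, Finset.empty_subset _, by omega, fun e he hs => by
      have := hE e he
      rw [Finset.subset_empty.1 hs, Finset.card_empty] at this
      omega⟩
  obtain ⟨A, hA, hAE⟩ : ∃ A ∈ U.powersetCard (2 * a), (edgesIn E A).card ≤ a := by
    by_contra! hcon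
    have hsum : ∑ A ∈ U.powersetCard (2 * a), (edgesIn E A).card =
        ∑ e ∈ edgesIn E U, ((U.powersetCard (2 * a)).filter (e ⊆ ·)).card := by
      have : ∀ A ∈ U.powersetCard (2 * a),
          (edgesIn E A).card = ∑ e ∈ edgesIn E U, if e ⊆ A then 1 else 0 := by
        intro A hA
        rw [← Finset.card_filter]
        congr 1
        ext e
        simp only [edgesIn, Finset.mem_filter]
        have := (Finset.mem_powersetCard.1 hA).1
        exact ⟨fun h => ⟨⟨h.1, h.2.trans this⟩, h.2⟩, fun h => ⟨h.1.1, h.2⟩⟩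
      rw [Finset.sum_congr rfl this, Finset.sum_comm]
      simp_rw [Finset.card_filter]
    have h1 : ∑ e ∈ edgesIn E U,
        (((U.powersetCard (2 * a)).filter (e ⊆ ·)).card * U.card ^ k) ≤
        (edgesIn E U).card * (U.card.choose (2 * a) * (2 * a) ^ k) := by
      have := Finset.sum_le_card_nsmul _ _ _ hcount
      rwa [smul_eq_mul] at this
    rw [← Finset.sum_mul, ← hsum] at h1
    have h2 : U.card.choose (2 * a) * (a + 1) ≤
        ∑ A ∈ U.powersetCard (2 * a), (edgesIn E A).card := by
      have := Finset.card_nsmul_le_sum _ _ (a + 1) hcon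
      rwa [Finset.card_powersetCard, smul_eq_mul] at this
    have hc : 0 < U.card.choose (2 * a) := Nat.choose_pos hU
    have h3 : U.card.choose (2 * a) * ((a + 1) * U.card ^ k) ≤
        U.card.choose (2 * a) * (a * U.card ^ k) := by
      calc _ = (U.card.choose (2 * a) * (a + 1)) * U.card ^ k := by ring
        _ ≤ _ := Nat.mul_le_mul_right _ h2
        _ ≤ _ := h1
        _ = U.card.choose (2 * a) * ((edgesIn E U).card * (2 * a) ^ k) := by ring
        _ ≤ _ := Nat.mul_le_mul_left _ h
    have h4 := Nat.le_of_mul_le_mul_left h3 hc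
    have h5 : 0 < U.card ^ k := pow_pos hUpos k
    nlinarith
  have hAU := (Finset.mem_powersetCard.1 hA)
  have hne : ∀ e ∈ edgesIn E A, e.Nonempty := fun e he =>
    Finset.card_pos.1 (by rw [hE e (mem_edgesIn.1 he).1]; omega)
  have : Nonempty V := (Finset.card_pos.1 hUpos).to_type
  choose! v hv using hne
  refine ⟨A \ (edgesIn E A).image v, Finset.sdiff_subset.trans hAU.1, ?_, fun e he hs => ?_⟩
  · have h1 := Finset.le_card_sdiff ((edgesIn E A).image v) A
    have h2 : ((edgesIn E A).image v).card ≤ (edgesIn E A).card := Finset.card_image_le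
    omega
  · have hin : e ∈ edgesIn E A := mem_edgesIn.2 ⟨he, hs.trans Finset.sdiff_subset⟩
    exact (Finset.mem_sdiff.1 (hs (hv e hin))).2 (Finset.mem_image_of_mem v hin)

end Colouring

section Defect

/-- The least number of vertices whose removal makes the hypergraph `r`-colourable. -/
noncomputable def defect {n : ℕ} (r : ℕ) (E : Finset (Finset (Fin n))) : ℕ :=
  sInf {m | ∃ W : Finset (Fin n), W.card = m ∧ ColorableOn E (Finset.univ \ W) r}

lemma defect_le {n r : ℕ} {E : Finset (Finset (Fin n))} {W : Finset (Fin n)}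
    (h : ColorableOn E (Finset.univ \ W) r) : defect r E ≤ W.card :=
  Nat.sInf_le ⟨W, rfl, h⟩

lemma exists_of_defect {n r : ℕ} {E : Finset (Finset (Fin n))} (hE : ∀ e ∈ E, e.Nonempty) :
    ∃ W : Finset (Fin n), W.card = defect r E ∧ ColorableOn E (Finset.univ \ W) r := by
  refine Nat.sInf_mem (s := {m | ∃ W : Finset (Fin n), W.card = m ∧
    ColorableOn E (Finset.univ \ W) r}) ⟨_, Finset.univ, rfl, fun _ => 0, ?_, ?_⟩
  · simp
  · intro e he hs
    rw [Finset.sdiff_self, Finset.subset_empty] at hs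
    exact absurd (hE e he) (by simp [hs])

lemma ColorableOn.insert_of_mem {n r : ℕ} {A B C : Finset (Finset (Fin n))} {v : Fin n}
    (hC : ∀ e ∈ C, v ∈ e) {W : Finset (Fin n)}
    (h : ColorableOn (A ∪ B) (Finset.univ \ W) r) :
    ColorableOn (A ∪ C) (Finset.univ \ insert v W) r := by
  obtain ⟨c, hc, hE⟩ := h
  have hsub : Finset.univ \ insert v W ⊆ Finset.univ \ W :=
    Finset.sdiff_subset_sdiff subset_rfl (Finset.subset_insert v W)
  refine ⟨c, fun x hx => hc x (hsub hx), fun e he hs => ?_⟩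
  rcases Finset.mem_union.1 he with he | he
  · exact hE e (Finset.mem_union_left _ he) (hs.trans hsub)
  · have := hs (hC e he)
    simp at this

lemma defect_lipschitz {n r : ℕ} {A B C : Finset (Finset (Fin n))} {v : Fin n}
    (hB : ∀ e ∈ B, v ∈ e) (hC : ∀ e ∈ C, v ∈ e) :
    defect r (A ∪ B) ≤ defect r (A ∪ C) + 1 := by
  by_cases h : ∃ W : Finset (Fin n), ColorableOn (A ∪ C) (Finset.univ \ W) r
  · obtain ⟨W, hW, hcol⟩ : ∃ W : Finset (Fin n), W.card = defect r (A ∪ C) ∧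
        ColorableOn (A ∪ C) (Finset.univ \ W) r := by
      obtain ⟨W, hW⟩ := h
      exact Nat.sInf_mem (s := {m | ∃ W : Finset (Fin n), W.card = m ∧
        ColorableOn (A ∪ C) (Finset.univ \ W) r}) ⟨_, W, rfl, hW⟩
    rw [← hW]
    exact (defect_le (hcol.insert_of_mem hB)).trans (Finset.card_insert_le v W)
  · have : {m | ∃ W : Finset (Fin n), W.card = m ∧
        ColorableOn (A ∪ B) (Finset.univ \ W) r} = ∅ := by
      refine Set.eq_empty_iff_forall_notMem.2 fun m hm => ?_
      obtain ⟨W, _, hW⟩ := hm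
      exact h ⟨_, hW.insert_of_mem hC⟩
    rw [defect, this, Nat.sInf_empty]
    exact Nat.zero_le _

/-- The `k`-subsets whose largest vertex is `v`. -/
def topBlock (n k : ℕ) (v : Fin n) : Finset (Finset (Fin n)) :=
  ((Finset.univ : Finset (Fin n)).powersetCard k).filter fun e => v ∈ e ∧ ∀ w ∈ e, w ≤ v

lemma biUnion_topBlock {n k : ℕ} (hk : 1 ≤ k) :
    Finset.univ.biUnion (topBlock n k) = (Finset.univ : Finset (Fin n)).powersetCard k := by
  ext e
  simp only [topBlock, Finset.mem_biUnion, Finset.mem_filter, Finset.mem_univ, true_and]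
  refine ⟨fun ⟨_, h, _⟩ => h, fun h => ?_⟩
  have hne : e.Nonempty := Finset.card_pos.1 (by
    rw [(Finset.mem_powersetCard.1 h).2]; exact hk)
  exact ⟨e.max' hne, h, e.max'_mem hne, fun w hw => e.le_max' w hw⟩

lemma defect_concentration {n k r : ℕ} (hk : 1 ≤ k) (hn : 0 < n) {p : ℝ} (h0 : 0 ≤ p)
    (h1 : p ≤ 1) {a b : ℝ} (hab : a ≤ b) :
    hyperProb n k p (fun E => (defect r E : ℝ) ≤ a) *
      hyperProb n k p (fun E => b ≤ (defect r E : ℝ)) ≤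
      Real.exp (-((b - a) ^ 2 / (4 * n))) := by
  rw [hyperProb_eq_subsetExp, hyperProb_eq_subsetExp, ← biUnion_topBlock hk]
  have := subsetExp_two_sided h0 h1 (Finset.univ : Finset (Fin n)) (by simpa using hn)
    (topBlock n k) ?_ (fun E => (defect r E : ℝ)) ?_ hab
  · simpa using this
  · intro i _ j _ hij
    refine Finset.disjoint_left.2 fun e hi hj => hij ?_
    simp only [topBlock, Finset.mem_filter] at hi hj
    exact le_antisymm (hj.2.2 i hi.2.1) (hi.2.2 j hj.2.1)
  · intro i _ A B hB C hC
    have := defect_lipschitz (r := r) (A := A) (v := i)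
      (fun e he => (Finset.mem_filter.1 (hB he)).2.1)
      (fun e he => (Finset.mem_filter.1 (hC he)).2.1)
    exact_mod_cast this

end Defect

section Density

lemma ind_exists_le {ι : Type*} (s : Finset ι) (P : ι → Prop) :
    ind (∃ i ∈ s, P i) ≤ ∑ i ∈ s, ind (P i) := by
  by_cases h : ∃ i ∈ s, P i
  · obtain ⟨i, hi, hp⟩ := h
    rw [ind_true ⟨i, hi, hp⟩, ← ind_true hp]
    exact Finset.single_le_sum (fun j _ => ind_nonneg (P j)) hi
  · rw [ind_false h]
    exact Finset.sum_nonneg fun j _ => ind_nonneg _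

lemma card_edgesIn_powersetCard {n k : ℕ} (U : Finset (Fin n)) :
    (edgesIn ((Finset.univ : Finset (Fin n)).powersetCard k) U).card = U.card.choose k := by
  rw [← Finset.card_powersetCard]
  congr 1
  ext e
  simp [mem_edgesIn, Finset.mem_powersetCard, and_comm]

/-- Chernoff bound for the number of edges inside a vertex set. -/
lemma hyperProb_edgesIn_ge {n k : ℕ} {p : ℝ} (h0 : 0 ≤ p) (h1 : p ≤ 1) (U : Finset (Fin n))
    {m B : ℝ} (hm : 0 < m) (hp : p * (U.card.choose k : ℝ) ≤ m) (hB : m ≤ B) :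
    hyperProb n k p (fun E => B ≤ ((edgesIn E U).card : ℝ)) ≤
      Real.exp (B * (1 + Real.log (m / B))) := by
  have hB0 : 0 < B := hm.trans_le hB
  set x : ℝ := B / m with hx
  have hx1 : 1 ≤ x := (one_le_div hm).2 hB
  have hx0 : 0 < x := by positivity
  rw [hyperProb_eq_subsetExp]
  set G := (Finset.univ : Finset (Fin n)).powersetCard k with hG
  calc _ ≤ subsetExp p G
        (fun E => Real.exp (-(B * Real.log x)) * ∏ e ∈ E, (if e ⊆ U then x else 1)) := by
        refine subsetExp_mono h0 h1 fun E _ => ?_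
        have hprod : ∏ e ∈ E, (if e ⊆ U then x else 1) = x ^ (edgesIn E U).card := by
          rw [Finset.prod_ite, Finset.prod_const_one, mul_one, Finset.prod_const]
          rfl
        rw [hprod, ← Real.exp_log (pow_pos hx0 _), Real.log_pow, ← Real.exp_add]
        by_cases h : B ≤ ((edgesIn E U).card : ℝ)
        · rw [ind_true h]
          exact Real.one_le_exp (by nlinarith [Real.log_nonneg hx1])
        · rw [ind_false h]; positivity
    _ = Real.exp (-(B * Real.log x)) * ∏ e ∈ G, (1 - p + p * (if e ⊆ U then x else 1)) := by
        rw [subsetExp_mul_left, subsetExp_prod]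
    _ ≤ Real.exp (-(B * Real.log x)) * ∏ e ∈ G, (if e ⊆ U then Real.exp (p * x) else 1) := by
        refine mul_le_mul_of_nonneg_left (Finset.prod_le_prod (fun e _ => ?_) fun e _ => ?_)
          (Real.exp_pos _).le
        · split_ifs <;> nlinarith
        · split_ifs
          · have := Real.add_one_le_exp (p * x)
            linarith
          · linarith
    _ = Real.exp (-(B * Real.log x) + (U.card.choose k : ℝ) * (p * x)) := by
        rw [Finset.prod_ite, Finset.prod_const_one, mul_one, Finset.prod_const, Real.exp_add,
          ← card_edgesIn_powersetCard U, ← Real.exp_nat_mul]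
        rfl
    _ ≤ _ := by
        apply Real.exp_le_exp.2
        have hl : Real.log (m / B) = -Real.log x := by rw [hx, ← Real.log_inv, inv_div]
        have : (U.card.choose k : ℝ) * (p * x) ≤ B := by
          calc _ = (p * (U.card.choose k : ℝ)) * x := by ring
            _ ≤ m * x := mul_le_mul_of_nonneg_right hp hx0.le
            _ = B := by rw [hx]; field_simp
        rw [hl]; linarith

/-- Upper bound on the edge density of a set of `u` among `n` vertices. -/
noncomputable def densityBound (n k : ℕ) (D b : ℝ) (u : ℕ) : ℝ :=
  max (Real.exp 2 * D * ((u : ℝ) / n) ^ (k - 1)) b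

lemma choose_mul_density_le {n k u : ℕ} (hk : 3 ≤ k) (hu : 0 < u) (hun : u ≤ n)
    {D b : ℝ} (hD : 0 < D) (hb : 1 ≤ b) (hDb : Real.exp (3 - b) * D ≤ 1 / 4) :
    (n.choose u : ℝ) * Real.exp ((densityBound n k D b u * u) *
      (1 + Real.log ((D * n * ((u : ℝ) / n) ^ k) / (densityBound n k D b u * u)))) ≤
      1 / n * (1 / 2) ^ u := by
  have hn : (0 : ℝ) < n := by exact_mod_cast hu.trans_le hun
  have hu' : (0 : ℝ) < u := by exact_mod_cast hu
  set l : ℝ := (u : ℝ) / n with hl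
  have hl0 : 0 < l := by positivity
  have hl1 : l ≤ 1 := (div_le_one hn).2 (by exact_mod_cast hun)
  set β := densityBound n k D b u with hβ
  have hβb : b ≤ β := le_max_right _ _
  have hβD : Real.exp 2 * D * l ^ (k - 1) ≤ β := le_max_left _ _
  have hβ0 : 0 < β := by linarith
  set ρ : ℝ := D * l ^ (k - 1) / β with hρ
  have hρ0 : 0 < ρ := by positivity
  have e1 : D * n * l ^ k / (β * u) = ρ := by
    have : l ^ k = l ^ (k - 1) * l := by rw [← pow_succ]; congr 1; omega
    rw [hρ, this, hl]; field_simp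
  rw [e1]
  have hlog : Real.log ρ ≤ -2 := by
    rw [Real.log_le_iff_le_exp hρ0, hρ, div_le_iff₀ hβ0]
    calc D * l ^ (k - 1) = Real.exp (-2) * (Real.exp 2 * D * l ^ (k - 1)) := by
          rw [← mul_assoc, ← mul_assoc, ← Real.exp_add]; simp
      _ ≤ _ := mul_le_mul_of_nonneg_left hβD (Real.exp_pos _).le
  have hρl : ρ ≤ D * l ^ 2 := by
    rw [hρ, div_le_iff₀ hβ0]
    have h2 : l ^ (k - 1) ≤ l ^ 2 := pow_le_pow_of_le_one hl0.le hl1 (by omega)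
    calc D * l ^ (k - 1) ≤ D * l ^ 2 * 1 := by rw [mul_one]; gcongr
      _ ≤ D * l ^ 2 * β := by gcongr; linarith
  have hchoose : (n.choose u : ℝ) ≤ (Real.exp 1 / l) ^ u := by
    have a1 := Nat.choose_le_pow_div (α := ℝ) u n
    have a2 := Real.pow_div_factorial_le_exp (u : ℝ) hu'.le u
    have a3 : (0 : ℝ) < (u.factorial : ℝ) := by exact_mod_cast Nat.factorial_pos u
    refine a1.trans ?_
    have : (Real.exp 1 / l) ^ u = Real.exp u * (n : ℝ) ^ u / (u : ℝ) ^ u := by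
      rw [hl, div_div_eq_mul_div, div_pow, mul_pow, ← Real.exp_nat_mul, mul_one]
    rw [this, div_le_div_iff₀ a3 (by positivity)]
    rw [div_le_iff₀ a3] at a2
    nlinarith [pow_pos hn u]
  have hexp : Real.exp (β * u * (1 + Real.log ρ)) ≤ (Real.exp (2 - b) * D * l ^ 2) ^ u := by
    calc _ ≤ Real.exp (u * (b * (1 + Real.log ρ))) := by
          apply Real.exp_le_exp.2
          nlinarith [mul_nonneg (mul_nonneg (sub_nonneg.2 hβb) hu'.le)
            (show 0 ≤ -(1 + Real.log ρ) by linarith)]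
      _ = (Real.exp (b * (1 + Real.log ρ))) ^ u := Real.exp_nat_mul _ _
      _ ≤ _ := by
          refine pow_le_pow_left₀ (Real.exp_pos _).le ?_ _
          calc _ ≤ Real.exp ((2 - b) + Real.log ρ) := by
                apply Real.exp_le_exp.2; nlinarith
            _ = Real.exp (2 - b) * ρ := by rw [Real.exp_add, Real.exp_log hρ0]
            _ ≤ Real.exp (2 - b) * (D * l ^ 2) := by gcongr
            _ = _ := by ring
  calc _ ≤ (Real.exp 1 / l) ^ u * (Real.exp (2 - b) * D * l ^ 2) ^ u :=
        mul_le_mul hchoose hexp (Real.exp_pos _).le (by positivity)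
    _ = ((Real.exp (3 - b) * D) * l) ^ u := by
        rw [← mul_pow]; congr 1
        have : Real.exp (3 - b) = Real.exp 1 * Real.exp (2 - b) := by
          rw [← Real.exp_add]; congr 1; ring
        rw [this]; field_simp
    _ ≤ (1 / 4 * l) ^ u := by gcongr
    _ ≤ l * (1 / 4) ^ u := by
        rw [mul_pow, mul_comm]
        refine mul_le_mul_of_nonneg_right ?_ (by positivity)
        simpa using pow_le_pow_of_le_one hl0.le hl1 hu
    _ = 1 / n * (u * (1 / 2) ^ u) * (1 / 2) ^ u := by
        rw [show (1 / 4 : ℝ) = 1 / 2 * (1 / 2) by norm_num, mul_pow, hl]; ring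
    _ ≤ _ := by
        have : (u : ℝ) * (1 / 2) ^ u ≤ 1 := by
          have h : (u : ℝ) ≤ 2 ^ u := by exact_mod_cast Nat.lt_two_pow_self.le
          rw [div_pow, one_pow, mul_one_div, div_le_one (by positivity)]
          exact h
        have h2 : 1 / (n : ℝ) * (u * (1 / 2) ^ u) ≤ 1 / n := by
          exact mul_le_of_le_one_right (by positivity) this
        gcongr

/-- With high probability no vertex set is too dense. -/
lemma hyperProb_dense_le {n k : ℕ} (hk : 3 ≤ k) (hn : 0 < n) {p : ℝ} (h0 : 0 ≤ p) (h1 : p ≤ 1)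
    {D b : ℝ} (hD : 0 < D) (hb : 1 ≤ b) (hDb : Real.exp (3 - b) * D ≤ 1 / 4)
    (hp : p * (n.choose k : ℝ) ≤ D * n) :
    hyperProb n k p (fun E => ∃ U : Finset (Fin n), U.Nonempty ∧
      densityBound n k D b U.card * U.card ≤ ((edgesIn E U).card : ℝ)) ≤ 1 / n := by
  have hn' : (0 : ℝ) < n := by exact_mod_cast hn
  rw [hyperProb_eq_subsetExp]
  set G := (Finset.univ : Finset (Fin n)).powersetCard k with hG
  set g : ℕ → ℝ := fun u => if u = 0 then 0 else
    Real.exp ((densityBound n k D b u * u) *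
      (1 + Real.log ((D * n * ((u : ℝ) / n) ^ k) / (densityBound n k D b u * u)))) with hg
  calc _ ≤ subsetExp p G (fun E => ∑ U ∈ (Finset.univ : Finset (Fin n)).powerset,
        ind (U.Nonempty ∧ densityBound n k D b U.card * U.card ≤ ((edgesIn E U).card : ℝ))) := by
        refine subsetExp_mono h0 h1 fun E _ => ?_
        have := ind_exists_le (Finset.univ : Finset (Fin n)).powerset (fun U =>
          U.Nonempty ∧ densityBound n k D b U.card * U.card ≤ ((edgesIn E U).card : ℝ))
        simpa using this
    _ = ∑ U ∈ (Finset.univ : Finset (Fin n)).powerset, subsetExp p G (fun E =>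
        ind (U.Nonempty ∧ densityBound n k D b U.card * U.card ≤ ((edgesIn E U).card : ℝ))) :=
        subsetExp_sum _ _ _ _
    _ ≤ ∑ U ∈ (Finset.univ : Finset (Fin n)).powerset, g U.card := by
        refine Finset.sum_le_sum fun U _ => ?_
        rcases U.eq_empty_or_nonempty with rfl | hU
        · have hg0 : g (∅ : Finset (Fin n)).card = 0 := by simp [hg]
          rw [hg0, ← subsetExp_const p G 0]
          exact subsetExp_mono h0 h1 fun E _ => (ind_false (by simp)).le
        · have hu : 0 < U.card := Finset.card_pos.2 hU
          have hu' : (0 : ℝ) < U.card := by exact_mod_cast hu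
          have hun : U.card ≤ n := by simpa using Finset.card_le_univ U
          simp only [hg, if_neg hu.ne', hU, true_and]
          rw [← hyperProb_eq_subsetExp]
          set l : ℝ := (U.card : ℝ) / n with hl
          have hl0 : 0 < l := by positivity
          refine hyperProb_edgesIn_ge h0 h1 U (by positivity) ?_ ?_
          · have hc : ((U.card.choose k : ℕ) : ℝ) * (n : ℝ) ^ k ≤
                (n.choose k : ℝ) * (U.card : ℝ) ^ k := by
              exact_mod_cast choose_mul_pow_le k hun
            calc p * (U.card.choose k : ℝ) ≤ p * ((n.choose k : ℝ) * l ^ k) := by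
                  refine mul_le_mul_of_nonneg_left ?_ h0
                  rw [hl, div_pow, ← mul_div_assoc, le_div_iff₀ (by positivity)]
                  exact hc
              _ = p * (n.choose k : ℝ) * l ^ k := by ring
              _ ≤ _ := mul_le_mul_of_nonneg_right hp (by positivity)
          · have hpow : l ^ k = l ^ (k - 1) * l := by rw [← pow_succ]; congr 1; omega
            have h2 : D * n * l ^ k = D * l ^ (k - 1) * U.card := by
              rw [hpow, hl]; field_simp
            rw [h2]
            refine mul_le_mul_of_nonneg_right ?_ hu'.le
            refine le_trans ?_ (le_max_left _ _)
            have : (1 : ℝ) ≤ Real.exp 2 := Real.one_le_exp (by norm_num)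
            rw [mul_assoc]
            exact le_mul_of_one_le_left (by positivity) this
    _ = ∑ u ∈ Finset.range (n + 1), (n.choose u : ℝ) * g u := by
        rw [Finset.sum_powerset_apply_card]; simp
    _ = ∑ u ∈ Finset.range n, (n.choose (u + 1) : ℝ) * g (u + 1) := by
        rw [Finset.sum_range_succ']; simp [hg]
    _ ≤ ∑ u ∈ Finset.range n, 1 / (n : ℝ) * (1 / 2) ^ (u + 1) := by
        refine Finset.sum_le_sum fun u hu => ?_
        simp only [hg, if_neg (Nat.succ_ne_zero u)]
        exact choose_mul_density_le hk (Nat.succ_pos u) (Finset.mem_range.1 hu) hD hb hDb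
    _ ≤ 1 / n := by
        rw [← Finset.mul_sum]
        refine mul_le_of_le_one_right (by positivity) ?_
        have h : ∀ m : ℕ, ∑ u ∈ Finset.range m, (1 / 2 : ℝ) ^ (u + 1) = 1 - (1 / 2) ^ m := by
          intro m
          induction m with
          | zero => simp
          | succ m ih => rw [Finset.sum_range_succ, ih]; ring
        rw [h]
        have : (0 : ℝ) ≤ (1 / 2) ^ n := by positivity
        linarith

end Density

section Occupancy

/-- Extension by colour `0` on `A` of a colouring of the complement of `A`. -/
def extendZero {α : Type*} [DecidableEq α] {m : ℕ} (A : Finset α) (d : {v // v ∉ A} → Fin m)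
    (v : α) : Fin (m + 1) :=
  if h : v ∈ A then 0 else (d ⟨v, h⟩).succ

/-- The number of points with image `j`. -/
def fiberCard {α β : Type*} [Fintype α] [DecidableEq β] (d : α → β) (j : β) : ℕ :=
  (Finset.univ.filter fun v => d v = j).card

lemma fiberCard_extendZero_succ {α : Type*} [Fintype α] [DecidableEq α] {m : ℕ} (A : Finset α)
    (d : {v // v ∉ A} → Fin m) (j : Fin m) :
    fiberCard (extendZero A d) j.succ = fiberCard d j := by
  unfold fiberCard
  rw [← Finset.card_map (Function.Embedding.subtype fun v => v ∉ A)]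
  congr 1
  ext v
  simp only [Finset.mem_filter, Finset.mem_univ, true_and, Finset.mem_map,
    Function.Embedding.subtype_apply, Subtype.exists, exists_and_right, exists_eq_right]
  constructor
  · intro h
    by_cases hv : v ∈ A
    · simp [extendZero, hv, (Fin.succ_ne_zero j).symm] at h
    · exact ⟨hv, by simpa [extendZero, hv] using h⟩
  · rintro ⟨hv, h⟩
    simp [extendZero, hv, h]

/-- Exponential generating function bound for sums over maps of products over fibres. -/
lemma sum_prod_fiberCard_fin_le {φ : ℕ → ℝ} (hφ : ∀ x, 0 ≤ φ x) {z : ℝ} (hz : 0 < z) (N m : ℕ)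
    (α : Type) [Fintype α] [DecidableEq α] (hα : Fintype.card α ≤ N) :
    (∑ d : α → Fin m, ∏ j, φ (fiberCard d j)) * z ^ Fintype.card α ≤
      (Fintype.card α).factorial *
        (∑ x ∈ Finset.range (N + 1), φ x * z ^ x / x.factorial) ^ m := by
  set Φ := ∑ x ∈ Finset.range (N + 1), φ x * z ^ x / x.factorial with hΦ
  have hΦ0 : 0 ≤ Φ := Finset.sum_nonneg fun x _ => by have := hφ x; positivity
  induction m generalizing α with
  | zero =>
    rcases isEmpty_or_nonempty α with h | ⟨⟨v⟩⟩
    · simp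
    · have : IsEmpty (α → Fin 0) := ⟨fun d => (d v).elim0⟩
      simp
  | succ m ih =>
    have hstep : ∀ A : Finset α,
        ∑ d : α → Fin (m + 1) with (Finset.univ.filter fun v => d v = 0) = A,
          ∏ j, φ (fiberCard d j) ≤
        φ A.card * ∑ d : {v // v ∉ A} → Fin m, ∏ j, φ (fiberCard d j) := by
      intro A
      have hinj : Function.Injective (extendZero (m := m) A) := by
        intro d d' h
        funext ⟨v, hv⟩
        have := congrFun h v
        simpa [extendZero, hv] using this
      have hsub : (Finset.univ.filter fun d : α → Fin (m + 1) =>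
          (Finset.univ.filter fun v => d v = 0) = A) ⊆
          Finset.univ.image (extendZero (m := m) A) := by
        intro d hd
        have hA : ∀ v, v ∈ A ↔ d v = 0 := by
          intro v
          rw [← (Finset.mem_filter.1 hd).2]; simp
        refine Finset.mem_image.2 ⟨fun v => (d v.1).pred fun h => v.2 ((hA v.1).2 h),
          Finset.mem_univ _, ?_⟩
        funext v
        by_cases hv : v ∈ A
        · simp [extendZero, hv, (hA v).1 hv]
        · simp [extendZero, hv]
      refine (Finset.sum_le_sum_of_subset_of_nonneg (f := fun d => φ A.card *
          ∏ j : Fin m, φ (fiberCard d j.succ)) hsub fun d _ _ => ?_).trans' ?_ |>.trans ?_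
      · exact mul_nonneg (hφ _) (Finset.prod_nonneg fun j _ => hφ _)
      · refine Finset.sum_le_sum fun d hd => ?_
        rw [Fin.prod_univ_succ, fiberCard, (Finset.mem_filter.1 hd).2]
      · rw [Finset.sum_image fun d _ d' _ h => hinj h, Finset.mul_sum]
        simp only [fiberCard_extendZero_succ, le_refl]
    calc _ = (∑ A : Finset α,
          ∑ d : α → Fin (m + 1) with (Finset.univ.filter fun v => d v = 0) = A,
            ∏ j, φ (fiberCard d j)) * z ^ Fintype.card α := by
          rw [Finset.sum_fiberwise]
      _ ≤ ∑ A : Finset α, φ A.card * z ^ A.card *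
            ((Fintype.card α - A.card).factorial * Φ ^ m) := by
          rw [Finset.sum_mul]
          refine Finset.sum_le_sum fun A _ => ?_
          have hc : Fintype.card {v // v ∉ A} = Fintype.card α - A.card := by
            rw [Fintype.card_subtype_compl]; simp
          have h := ih {v // v ∉ A} (by omega)
          rw [hc] at h
          have hz' : z ^ Fintype.card α = z ^ A.card * z ^ (Fintype.card α - A.card) := by
            rw [← pow_add, Nat.add_sub_cancel' (Finset.card_le_univ A)]
          calc _ ≤ (φ A.card * ∑ d : {v // v ∉ A} → Fin m, ∏ j, φ (fiberCard d j)) *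
                z ^ Fintype.card α := mul_le_mul_of_nonneg_right (hstep A) (by positivity)
            _ = φ A.card * z ^ A.card * ((∑ d : {v // v ∉ A} → Fin m, ∏ j, φ (fiberCard d j)) *
                z ^ (Fintype.card α - A.card)) := by rw [hz']; ring
            _ ≤ _ := mul_le_mul_of_nonneg_left h (mul_nonneg (hφ _) (by positivity))
      _ = ∑ x ∈ Finset.range (Fintype.card α + 1), ((Fintype.card α).choose x : ℝ) *
            (φ x * z ^ x * ((Fintype.card α - x).factorial * Φ ^ m)) := by
          rw [← Finset.powerset_univ, Finset.sum_powerset_apply_card (fun x => φ x * z ^ x *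
            (((Fintype.card α - x).factorial : ℝ) * Φ ^ m)), Finset.card_univ]
          simp
      _ = (Fintype.card α).factorial * Φ ^ m *
            ∑ x ∈ Finset.range (Fintype.card α + 1), φ x * z ^ x / x.factorial := by
          rw [Finset.mul_sum]
          refine Finset.sum_congr rfl fun x hx => ?_
          have hx' : x ≤ Fintype.card α := Nat.lt_succ_iff.1 (Finset.mem_range.1 hx)
          rw [Nat.cast_choose ℝ hx']
          have h1 : ((x.factorial : ℕ) : ℝ) ≠ 0 := by exact_mod_cast x.factorial_ne_zero
          have h2 : (((Fintype.card α - x).factorial : ℕ) : ℝ) ≠ 0 := by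
            exact_mod_cast Nat.factorial_ne_zero _
          field_simp
      _ ≤ (Fintype.card α).factorial * Φ ^ m * Φ := by
          refine mul_le_mul_of_nonneg_left ?_ (by positivity)
          refine Finset.sum_le_sum_of_subset_of_nonneg
            (Finset.range_subset_range.2 (by omega)) fun x _ _ => ?_
          have := hφ x
          positivity
      _ = _ := by rw [pow_succ]; ring

lemma sum_prod_fiberCard_le {φ : ℕ → ℝ} (hφ : ∀ x, 0 ≤ φ x) {z : ℝ} (hz : 0 < z) (n : ℕ)
    (β : Type) [Fintype β] [DecidableEq β] :
    (∑ d : Fin n → β, ∏ j, φ (fiberCard d j)) * z ^ n ≤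
      n.factorial * (∑ x ∈ Finset.range (n + 1), φ x * z ^ x / x.factorial) ^
        Fintype.card β := by
  have h := sum_prod_fiberCard_fin_le hφ hz n (Fintype.card β) (Fin n) (by simp)
  rw [Fintype.card_fin] at h
  refine le_trans (le_of_eq ?_) h
  congr 1
  let e := Fintype.equivFin β
  refine Fintype.sum_equiv (Equiv.arrowCongr (Equiv.refl _) e) _ _ fun d => ?_
  refine Fintype.prod_equiv e _ _ fun j => ?_
  congr 1
  simp [fiberCard]

end Occupancy

section SecondMoment

variable {n k r T : ℕ}

lemma exists_truncation (T : ℕ) (c : Fin n → Fin r) :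
    ∃ K : Fin r → Finset (Fin n), ∀ i, (∀ v ∈ K i, c v = i) ∧ (K i).card = min (fiberCard c i) T := by
  have h : ∀ i : Fin r, ∃ K : Finset (Fin n), (∀ v ∈ K, c v = i) ∧
      K.card = min (fiberCard c i) T := by
    intro i
    obtain ⟨K, hK, hc⟩ := Finset.exists_subset_card_eq
      (s := Finset.univ.filter fun v => c v = i) (n := min (fiberCard c i) T)
      (min_le_left _ _)
    exact ⟨K, fun v hv => (Finset.mem_filter.1 (hK hv)).2, hc⟩
  choose K hK using h
  exact ⟨K, hK⟩

/-- The first `T` vertices of every colour class of `c`. -/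
noncomputable def truncation (T : ℕ) (c : Fin n → Fin r) : Fin r → Finset (Fin n) :=
  (exists_truncation T c).choose

lemma eq_of_mem_truncation {c : Fin n → Fin r} {i : Fin r} {v : Fin n}
    (h : v ∈ truncation T c i) : c v = i :=
  ((exists_truncation T c).choose_spec i).1 v h

lemma card_truncation (T : ℕ) (c : Fin n → Fin r) (i : Fin r) :
    (truncation T c i).card = min (fiberCard c i) T :=
  ((exists_truncation T c).choose_spec i).2

/-- The `k`-sets contained in one of the truncated colour classes of `c`. -/
noncomputable def forbidden (k T : ℕ) (c : Fin n → Fin r) : Finset (Finset (Fin n)) :=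
  ((Finset.univ : Finset (Fin n)).powersetCard k).filter fun e => ∃ i, e ⊆ truncation T c i

lemma defect_le_of_disjoint (hk : 1 ≤ k) (c : Fin n → Fin r) {E : Finset (Finset (Fin n))}
    (hE : E ⊆ (Finset.univ : Finset (Fin n)).powersetCard k)
    (h : Disjoint (forbidden k T c) E) :
    defect r E ≤ ∑ i, (fiberCard c i - T) := by
  set S := Finset.univ.biUnion (truncation T c) with hS
  have hcol : ColorableOn E (Finset.univ \ (Finset.univ \ S)) r := by
    refine ⟨fun v => c v, fun v _ => (c v).2, fun e he hs hm => ?_⟩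
    have hcard := (Finset.mem_powersetCard.1 (hE he)).2
    obtain ⟨v, hv⟩ := Finset.card_pos.1 (show 0 < e.card by omega)
    refine Finset.disjoint_left.1 h (Finset.mem_filter.2 ⟨hE he, c v, fun w hw => ?_⟩) he
    have hw' := hs hw
    simp only [hS, Finset.mem_sdiff, Finset.mem_univ, true_and, not_not, Finset.mem_biUnion] at hw'
    obtain ⟨j, hj⟩ := hw'
    have h1 : (c w : ℕ) = c v := hm w hw v hv
    rw [← Fin.ext h1, eq_of_mem_truncation hj]
    exact hj
  refine (defect_le hcol).trans ?_
  have hsub : Finset.univ \ S ⊆ Finset.univ.biUnion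
      fun i => (Finset.univ.filter fun v => c v = i) \ truncation T c i := by
    intro v hv
    simp only [hS, Finset.mem_sdiff, Finset.mem_univ, true_and, Finset.mem_biUnion,
      not_exists] at hv
    simp only [Finset.mem_biUnion, Finset.mem_sdiff, Finset.mem_filter, Finset.mem_univ, true_and]
    exact ⟨c v, rfl, hv _⟩
  refine (Finset.card_le_card hsub).trans (Finset.card_biUnion_le.trans ?_)
  refine Finset.sum_le_sum fun i _ => ?_
  rw [Finset.card_sdiff_of_subset fun v hv => Finset.mem_filter.2
    ⟨Finset.mem_univ _, eq_of_mem_truncation hv⟩, card_truncation]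
  unfold fiberCard
  omega

lemma card_forbidden_inter_le (c c' : Fin n → Fin r) :
    (forbidden k T c ∩ forbidden k T c').card ≤
      ∑ j : Fin r × Fin r, (min (fiberCard (fun v => (c v, c' v)) j) T).choose k := by
  have hsub : forbidden k T c ∩ forbidden k T c' ⊆ Finset.univ.biUnion
      fun j : Fin r × Fin r => (truncation T c j.1 ∩ truncation T c' j.2).powersetCard k := by
    intro e he
    simp only [forbidden, Finset.mem_inter, Finset.mem_filter] at he
    obtain ⟨⟨h1, i, hi⟩, _, j, hj⟩ := he
    exact Finset.mem_biUnion.2 ⟨(i, j), Finset.mem_univ _, Finset.mem_powersetCard.2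
      ⟨Finset.subset_inter hi hj, (Finset.mem_powersetCard.1 h1).2⟩⟩
  refine (Finset.card_le_card hsub).trans (Finset.card_biUnion_le.trans ?_)
  refine Finset.sum_le_sum fun j _ => ?_
  rw [Finset.card_powersetCard]
  refine Nat.choose_le_choose k (le_min ?_ ?_)
  · refine Finset.card_le_card fun v hv => ?_
    rw [Finset.mem_inter] at hv
    simp [eq_of_mem_truncation hv.1, eq_of_mem_truncation hv.2]
  · refine (Finset.card_le_card Finset.inter_subset_left).trans ?_
    rw [card_truncation]
    exact min_le_right _ _

/-- The second moment method applied to truncated colourings. -/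
lemma sq_card_le_hyperProb_defect_mul (hk : 1 ≤ k) {p y z M : ℝ} (h0 : 0 ≤ p) (h1 : p < 1)
    (hy : (1 - p)⁻¹ ≤ Real.exp y) (hz : 0 < z) (C : Finset (Fin n → Fin r))
    (hC : ∀ c ∈ C, ((∑ i, (fiberCard c i - T) : ℕ) : ℝ) ≤ M) :
    (C.card : ℝ) ^ 2 * z ^ n ≤ hyperProb n k p (fun E => (defect r E : ℝ) ≤ M) *
      (n.factorial * (∑ x ∈ Finset.range (n + 1),
        Real.exp (y * ((min x T).choose k : ℝ)) * z ^ x / x.factorial) ^ (r * r)) := by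
  set G := (Finset.univ : Finset (Fin n)).powersetCard k with hG
  have hq : 0 < 1 - p := by linarith
  set F : (Fin n → Fin r) → Finset (Finset (Fin n)) := forbidden k T with hF
  have hFG : ∀ c, F c ⊆ G := fun c => Finset.filter_subset _ _
  set X : Finset (Finset (Fin n)) → ℝ := fun E =>
    ∑ c ∈ C, ((1 - p) ^ (F c).card)⁻¹ * ind (Disjoint (F c) E) with hX
  have hEX : subsetExp p G X = C.card := by
    rw [hX, subsetExp_sum, Finset.card_eq_sum_ones, Nat.cast_sum]
    refine Finset.sum_congr rfl fun c _ => ?_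
    rw [subsetExp_mul_left, subsetExp_disjoint p (hFG c), inv_mul_cancel₀ (by positivity)]
    simp
  have hpair : ∀ c c', subsetExp p G (fun E => (((1 - p) ^ (F c).card)⁻¹ * ind (Disjoint (F c) E)) *
      (((1 - p) ^ (F c').card)⁻¹ * ind (Disjoint (F c') E))) ≤
      ∏ j : Fin r × Fin r,
        Real.exp (y * ((min (fiberCard (fun v => (c v, c' v)) j) T).choose k : ℝ)) := by
    intro c c'
    have hind : ∀ E, ind (Disjoint (F c) E) * ind (Disjoint (F c') E) =
        ind (Disjoint (F c ∪ F c') E) := by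
      intro E
      simp only [ind, Finset.disjoint_union_left]
      split_ifs <;> simp_all
    have hfun : (fun E => (((1 - p) ^ (F c).card)⁻¹ * ind (Disjoint (F c) E)) *
      (((1 - p) ^ (F c').card)⁻¹ * ind (Disjoint (F c') E))) = fun E =>
      (((1 - p) ^ (F c).card)⁻¹ * ((1 - p) ^ (F c').card)⁻¹) * ind (Disjoint (F c ∪ F c') E) := by
      funext E
      rw [← hind]
      ring
    rw [hfun, subsetExp_mul_left, subsetExp_disjoint p (Finset.union_subset (hFG c) (hFG c'))]
    have hcard := Finset.card_union_add_card_inter (F c) (F c')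
    have heq : ((1 - p) ^ (F c).card)⁻¹ * ((1 - p) ^ (F c').card)⁻¹ * (1 - p) ^ (F c ∪ F c').card =
        ((1 - p)⁻¹) ^ (F c ∩ F c').card := by
      rw [inv_pow, ← mul_inv, ← pow_add, ← hcard, pow_add]
      field_simp
    rw [heq, ← Real.exp_sum, ← Finset.mul_sum]
    have hle := card_forbidden_inter_le (k := k) (T := T) c c'
    have hone : 1 ≤ (1 - p)⁻¹ := (one_le_inv₀ hq).2 (by linarith)
    calc ((1 - p)⁻¹) ^ (F c ∩ F c').card ≤ ((1 - p)⁻¹) ^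
          (∑ j : Fin r × Fin r, (min (fiberCard (fun v => (c v, c' v)) j) T).choose k) :=
          pow_le_pow_right₀ hone hle
      _ ≤ Real.exp y ^
          (∑ j : Fin r × Fin r, (min (fiberCard (fun v => (c v, c' v)) j) T).choose k) := by
          gcongr
      _ = _ := by rw [← Real.exp_nat_mul, mul_comm]; push_cast; rfl
  set φ : ℕ → ℝ := fun x => Real.exp (y * ((min x T).choose k : ℝ)) with hφ
  have hEX2 : subsetExp p G (fun E => X E ^ 2) ≤
      ∑ d : Fin n → Fin r × Fin r, ∏ j, φ (fiberCard d j) := by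
    have : (fun E => X E ^ 2) = fun E => ∑ c ∈ C, ∑ c' ∈ C,
        (((1 - p) ^ (F c).card)⁻¹ * ind (Disjoint (F c) E)) *
        (((1 - p) ^ (F c').card)⁻¹ * ind (Disjoint (F c') E)) := by
      funext E
      rw [hX, sq, Finset.sum_mul_sum]
    rw [this, subsetExp_sum]
    simp_rw [subsetExp_sum]
    calc _ ≤ ∑ c ∈ C, ∑ c' ∈ C, ∏ j : Fin r × Fin r, φ (fiberCard (fun v => (c v, c' v)) j) :=
          Finset.sum_le_sum fun c _ => Finset.sum_le_sum fun c' _ => hpair c c'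
      _ = ∑ x ∈ C ×ˢ C, ∏ j : Fin r × Fin r, φ (fiberCard (fun v => (x.1 v, x.2 v)) j) := by
          rw [Finset.sum_product]
      _ ≤ ∑ x : (Fin n → Fin r) × (Fin n → Fin r),
            ∏ j : Fin r × Fin r, φ (fiberCard (fun v => (x.1 v, x.2 v)) j) :=
          Finset.sum_le_sum_of_subset_of_nonneg (Finset.subset_univ _) fun x _ _ =>
            Finset.prod_nonneg fun j _ => (Real.exp_pos _).le
      _ = _ := (Fintype.sum_equiv (Equiv.arrowProdEquivProdArrow (Fin n) (fun _ => Fin r)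
            (fun _ => Fin r)) _ _ fun d => rfl).symm
  have hCS := subsetExp_sq_le h0 h1.le G X (fun E => (defect r E : ℝ) ≤ M) (by
    intro E hE hM
    refine Finset.sum_eq_zero fun c hc => ?_
    rw [ind_false, mul_zero]
    intro hd
    refine hM (le_trans ?_ (hC c hc))
    exact_mod_cast defect_le_of_disjoint hk c hE hd)
  rw [hEX] at hCS
  rw [hyperProb_eq_subsetExp]
  have hP0 : 0 ≤ subsetExp p G (fun E => ind ((defect r E : ℝ) ≤ M)) := by
    rw [← subsetExp_const p G 0]
    exact subsetExp_mono h0 h1.le fun E _ => ind_nonneg _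
  have hocc := sum_prod_fiberCard_le (φ := φ) (fun x => (Real.exp_pos _).le) hz n (Fin r × Fin r)
  rw [Fintype.card_prod, Fintype.card_fin] at hocc
  calc (C.card : ℝ) ^ 2 * z ^ n ≤ subsetExp p G (fun E => ind ((defect r E : ℝ) ≤ M)) *
        (∑ d : Fin n → Fin r × Fin r, ∏ j, φ (fiberCard d j)) * z ^ n := by
        refine mul_le_mul_of_nonneg_right (hCS.trans ?_) (by positivity)
        exact mul_le_mul_of_nonneg_left hEX2 hP0
    _ ≤ _ := by
        rw [mul_assoc]
        exact mul_le_mul_of_nonneg_left hocc hP0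

end SecondMoment

section Truncation

lemma sum_exp_fiberCard (n r : ℕ) (h : ℝ) (i : Fin r) :
    ∑ c : Fin n → Fin r, Real.exp (h * fiberCard c i) = ((r : ℝ) - 1 + Real.exp h) ^ n := by
  have h1 : ∑ a : Fin r, (if a = i then Real.exp h else 1) = (r : ℝ) - 1 + Real.exp h := by
    have : ∀ a : Fin r, (if a = i then Real.exp h else 1) =
        1 + if a = i then Real.exp h - 1 else 0 := by
      intro a; split_ifs <;> ring
    simp_rw [this, Finset.sum_add_distrib, Finset.sum_ite_eq' Finset.univ i]
    simp
    ring
  rw [← h1, Fintype.sum_pow]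
  refine Finset.sum_congr rfl fun c _ => ?_
  rw [Finset.prod_ite, Finset.prod_const, Finset.prod_const_one, mul_one, ← Real.exp_nat_mul,
    mul_comm]
  rfl

/-- At least half of all colourings have few vertices exceeding the threshold `T` in their
colour classes. -/
lemma half_le_card_few_dropped {n r T : ℕ} (hr : 0 < r) {h M : ℝ} (h0 : 0 < h) (h1 : h ≤ 1)
    (hT : (1 + h) * ((n : ℝ) / r) ≤ T) (hM : 2 * r / h ≤ M) :
    (r : ℝ) ^ n / 2 ≤ ((Finset.univ.filter fun c : Fin n → Fin r =>
      ((∑ i, (fiberCard c i - T) : ℕ) : ℝ) ≤ M).card : ℝ) := by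
  have hr' : (0 : ℝ) < r := by exact_mod_cast hr
  have hpt : ∀ x : ℕ, ((x - T : ℕ) : ℝ) ≤ Real.exp (-(h * T)) / h * Real.exp (h * x) := by
    intro x
    rw [div_mul_eq_mul_div, ← Real.exp_add, le_div_iff₀ h0]
    rcases le_total x T with hx | hx
    · rw [Nat.sub_eq_zero_of_le hx]
      simp [(Real.exp_pos _).le]
    · rw [Nat.cast_sub hx]
      have := Real.add_one_le_exp (-(h * T) + h * x)
      linarith
  have hexp : Real.exp h ≤ 1 + h + h ^ 2 := by
    have := Real.abs_exp_sub_one_sub_id_le (abs_le.2 ⟨by linarith, h1⟩)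
    linarith [(abs_le.1 this).2]
  have hpow : ((r : ℝ) - 1 + Real.exp h) ^ n ≤ (r : ℝ) ^ n * Real.exp (h * T) := by
    have hb : (r : ℝ) - 1 + Real.exp h ≤ r * Real.exp ((h + h ^ 2) / r) := by
      have := Real.add_one_le_exp ((h + h ^ 2) / r)
      have h2 := mul_le_mul_of_nonneg_left this hr'.le
      rw [mul_add, mul_div_cancel₀ _ hr'.ne'] at h2
      linarith
    have hb0 : 0 ≤ (r : ℝ) - 1 + Real.exp h := by
      have : (1 : ℝ) ≤ r := by exact_mod_cast hr
      have := Real.exp_pos h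
      linarith
    calc _ ≤ (r * Real.exp ((h + h ^ 2) / r)) ^ n := pow_le_pow_left₀ hb0 hb n
      _ = (r : ℝ) ^ n * Real.exp (h * ((1 + h) * ((n : ℝ) / r))) := by
          rw [mul_pow, ← Real.exp_nat_mul]
          congr 2
          ring
      _ ≤ _ := by gcongr
  have hsum : ∑ c : Fin n → Fin r, ((∑ i, (fiberCard c i - T) : ℕ) : ℝ) ≤ (r : ℝ) ^ n * (r / h) := by
    calc _ ≤ ∑ c : Fin n → Fin r, ∑ i, Real.exp (-(h * T)) / h * Real.exp (h * fiberCard c i) := by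
          push_cast
          exact Finset.sum_le_sum fun c _ => Finset.sum_le_sum fun i _ => hpt _
      _ = r * (Real.exp (-(h * T)) / h * ((r : ℝ) - 1 + Real.exp h) ^ n) := by
          rw [Finset.sum_comm]
          simp_rw [← Finset.mul_sum, sum_exp_fiberCard]
          simp
          ring
      _ ≤ r * (Real.exp (-(h * T)) / h * ((r : ℝ) ^ n * Real.exp (h * T))) := by gcongr
      _ = _ := by
          rw [Real.exp_neg]
          field_simp
  set B := Finset.univ.filter fun c : Fin n → Fin r =>
      ((∑ i, (fiberCard c i - T) : ℕ) : ℝ) ≤ M with hB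
  have hcard : (B.card : ℝ) + ((Finset.univ.filter fun c : Fin n → Fin r =>
      ¬ ((∑ i, (fiberCard c i - T) : ℕ) : ℝ) ≤ M).card : ℝ) = (r : ℝ) ^ n := by
    rw [← Nat.cast_add, Finset.card_filter_add_card_filter_not]
    simp
  have hbad : ((Finset.univ.filter fun c : Fin n → Fin r =>
      ¬ ((∑ i, (fiberCard c i - T) : ℕ) : ℝ) ≤ M).card : ℝ) * (2 * r / h) ≤
      (r : ℝ) ^ n * (r / h) := by
    refine le_trans ?_ hsum
    rw [← nsmul_eq_mul]
    refine (Finset.card_nsmul_le_sum _ _ _ fun c hc => ?_).trans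
      (Finset.sum_le_sum_of_subset_of_nonneg (Finset.filter_subset _ _) fun c _ _ => by positivity)
    exact hM.trans (not_le.1 (Finset.mem_filter.1 hc).2).le
  have hrh : 0 < (r : ℝ) / h := by positivity
  rw [mul_div_assoc, ← mul_assoc] at hbad
  have := le_of_mul_le_mul_right hbad hrh
  linarith

end Truncation

section Moments

lemma factorial_mul_exp_le {n : ℕ} (hn : 1 ≤ n) :
    (n.factorial : ℝ) * Real.exp n ≤ Real.exp 1 * n * (n : ℝ) ^ n := by
  induction n, hn using Nat.le_induction with
  | base => simp
  | succ n hn ih =>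
    have hn0 : (0 : ℝ) < n := by exact_mod_cast hn
    have h1 : (n : ℝ) ≤ (n + 1) * Real.exp (-(1 / (n + 1))) := by
      have := Real.add_one_le_exp (-(1 / ((n : ℝ) + 1)))
      have h2 := mul_le_mul_of_nonneg_left this (show (0 : ℝ) ≤ n + 1 by positivity)
      rw [mul_add, mul_neg, mul_one_div_cancel (by positivity)] at h2
      linarith
    have h2 : (n : ℝ) ^ (n + 1) * Real.exp 1 ≤ (n + 1) ^ (n + 1) := by
      have := pow_le_pow_left₀ hn0.le h1 (n + 1)
      rw [mul_pow, ← Real.exp_nat_mul] at this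
      have he : ((n + 1 : ℕ) : ℝ) * -(1 / (n + 1)) = -1 := by
        push_cast
        field_simp
      rw [he, Real.exp_neg] at this
      calc _ ≤ ((n : ℝ) + 1) ^ (n + 1) * (Real.exp 1)⁻¹ * Real.exp 1 := by gcongr
        _ = _ := by field_simp
    rw [Nat.factorial_succ]
    push_cast
    rw [Real.exp_add]
    calc ((n : ℝ) + 1) * n.factorial * (Real.exp n * Real.exp 1)
        = (n + 1) * (n.factorial * Real.exp n) * Real.exp 1 := by ring
      _ ≤ (n + 1) * (Real.exp 1 * n * (n : ℝ) ^ n) * Real.exp 1 := by gcongr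
      _ = Real.exp 1 * (n + 1) * ((n : ℝ) ^ (n + 1) * Real.exp 1) := by ring
      _ ≤ _ := by gcongr

lemma sum_truncated_le {k T n X : ℕ} (hk : 2 ≤ k) (hT : 0 < T) (hX : 0 < X)
    {z y A θ ξ q κ : ℝ} (hz : 0 < z) (hA : 0 ≤ A) (hθ : 0 ≤ θ) (hξ : 0 < ξ) (hκ : 0 ≤ κ)
    (hexp : ∀ m ≤ T, y * (m.choose k : ℝ) ≤ A * m * ((m : ℝ) / T) ^ (k - 1))
    (hAξ : A * ξ ^ (k - 1) ≤ θ) (hAX : A * X ^ k ≤ (T : ℝ) ^ (k - 1))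
    (hq : Real.exp A * Real.exp 1 * z / (ξ * T) ≤ q) (hq2 : q ≤ 1 / 2)
    (hqX : 4 * q ^ X ≤ κ * z)
    (hsmall : ξ * T < X → z ≤ 1 ∧ 2 * X * Real.exp 1 * z ≤ κ) :
    ∑ x ∈ Finset.range (n + 1), Real.exp (y * ((min x T).choose k : ℝ)) * z ^ x / x.factorial ≤
      Real.exp (z * Real.exp θ) + κ * z := by
  have hT' : (0 : ℝ) < T := by exact_mod_cast hT
  have hX' : (0 : ℝ) < X := by exact_mod_cast hX
  have hq0 : 0 < q := lt_of_lt_of_le (by positivity) hq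
  have hpt : ∀ x : ℕ, Real.exp (y * ((min x T).choose k : ℝ)) * z ^ x / x.factorial ≤
      (z * Real.exp θ) ^ x / x.factorial + (if x < X then κ * z / (2 * X) else 0) +
        (if X ≤ x then q ^ x else 0) := by
    intro x
    have hf : (0 : ℝ) < x.factorial := by exact_mod_cast x.factorial_pos
    have hm := hexp (min x T) (min_le_right _ _)
    set m := min x T with hmdef
    have hmx : (m : ℝ) ≤ x := by exact_mod_cast min_le_left x T
    have hmT : (m : ℝ) ≤ T := by exact_mod_cast min_le_right x T
    have hm0 : (0 : ℝ) ≤ m := by positivity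
    have hi1 : 0 ≤ (if x < X then κ * z / (2 * X) else 0) := by split_ifs <;> positivity
    have hi2 : 0 ≤ (if X ≤ x then q ^ x else 0) := by split_ifs <;> positivity
    have hi0 : 0 ≤ (z * Real.exp θ) ^ x / x.factorial := by positivity
    by_cases hs : y * (m.choose k : ℝ) ≤ θ * x
    · have : Real.exp (y * (m.choose k : ℝ)) * z ^ x / x.factorial ≤
          (z * Real.exp θ) ^ x / x.factorial := by
        rw [mul_pow, ← Real.exp_nat_mul, mul_comm (z ^ x), mul_comm (x : ℝ)]
        gcongr
      linarith
    have hmξ : ξ * T < m := by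
      by_contra hcon
      refine hs (hm.trans ?_)
      have h1 : (m : ℝ) / T ≤ ξ := (div_le_iff₀ hT').2 (not_lt.1 hcon)
      calc A * m * ((m : ℝ) / T) ^ (k - 1) ≤ A * m * ξ ^ (k - 1) := by gcongr
        _ = A * ξ ^ (k - 1) * m := by ring
        _ ≤ θ * x := by gcongr
    have hkx : k ≤ x := by
      by_contra hcon
      refine hs ?_
      rw [Nat.choose_eq_zero_of_lt (by omega)]
      simpa using mul_nonneg hθ (Nat.cast_nonneg x)
    rcases lt_or_ge x X with hxX | hxX
    · have hxX' : (x : ℝ) < X := by exact_mod_cast hxX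
      obtain ⟨hz1, hzs⟩ := hsmall (hmξ.trans (hmx.trans_lt hxX'))
      have h1 : y * (m.choose k : ℝ) ≤ 1 := by
        refine hm.trans ?_
        calc A * m * ((m : ℝ) / T) ^ (k - 1) ≤ A * X * ((X : ℝ) / T) ^ (k - 1) := by
              have : (m : ℝ) ≤ X := hmx.trans hxX'.le
              gcongr
          _ = A * X ^ k / T ^ (k - 1) := by
              rw [div_pow]
              nth_rewrite 3 [show k = (k - 1) + 1 by omega]
              rw [pow_succ]
              ring
          _ ≤ 1 := (div_le_one (by positivity)).2 hAX
      have h2 : Real.exp (y * (m.choose k : ℝ)) * z ^ x / x.factorial ≤ κ * z / (2 * X) := by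
        calc _ ≤ Real.exp 1 * z ^ 2 / 1 := by
              gcongr ?_ * ?_ / ?_
              · exact Real.exp_le_exp.2 h1
              · exact pow_le_pow_of_le_one hz.le hz1 (hk.trans hkx)
              · exact_mod_cast x.factorial_pos
          _ ≤ _ := by
              rw [div_one, le_div_iff₀ (by positivity)]
              nlinarith
      rw [if_pos hxX]
      linarith
    · rw [if_pos hxX]
      have hx0 : (0 : ℝ) < x := by exact_mod_cast (hX.trans_le hxX)
      have h1 : y * (m.choose k : ℝ) ≤ x * A := by
        refine hm.trans ?_
        have : ((m : ℝ) / T) ^ (k - 1) ≤ 1 := pow_le_one₀ (by positivity) ((div_le_one hT').2 hmT)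
        calc A * m * ((m : ℝ) / T) ^ (k - 1) ≤ A * x * 1 := by gcongr
          _ = x * A := by ring
      have h2 : z ^ x / x.factorial ≤ (z * Real.exp 1 / x) ^ x := by
        have h3 := Real.pow_div_factorial_le_exp (x : ℝ) hx0.le x
        rw [div_pow, mul_pow, ← Real.exp_nat_mul, mul_one, le_div_iff₀ (by positivity)]
        calc z ^ x / x.factorial * (x : ℝ) ^ x = z ^ x * ((x : ℝ) ^ x / x.factorial) := by ring
          _ ≤ _ := by gcongr
      have h3 : Real.exp (y * (m.choose k : ℝ)) * z ^ x / x.factorial ≤ q ^ x := by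
        calc _ = Real.exp (y * (m.choose k : ℝ)) * (z ^ x / x.factorial) := by ring
          _ ≤ Real.exp (x * A) * (z * Real.exp 1 / x) ^ x := by gcongr
          _ = (Real.exp A * Real.exp 1 * z / x) ^ x := by
              rw [Real.exp_nat_mul, ← mul_pow]
              congr 1
              ring
          _ ≤ (Real.exp A * Real.exp 1 * z / (ξ * T)) ^ x := by
              have := hmξ.le.trans hmx
              gcongr
          _ ≤ q ^ x := by gcongr
      linarith
  refine (Finset.sum_le_sum fun x _ => hpt x).trans ?_
  rw [Finset.sum_add_distrib, Finset.sum_add_distrib]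
  have hs1 : ∑ x ∈ Finset.range (n + 1), (z * Real.exp θ) ^ x / x.factorial ≤
      Real.exp (z * Real.exp θ) := Real.sum_le_exp_of_nonneg (by positivity) _
  have hs2 : ∑ x ∈ Finset.range (n + 1), (if x < X then κ * z / (2 * X) else 0) ≤ κ * z / 2 := by
    rw [← Finset.sum_filter, Finset.sum_const, nsmul_eq_mul]
    have hc : (((Finset.range (n + 1)).filter fun x => x < X).card : ℝ) ≤ X := by
      have : ((Finset.range (n + 1)).filter fun x => x < X).card ≤ (Finset.range X).card :=
        Finset.card_le_card fun x hx => Finset.mem_range.2 (Finset.mem_filter.1 hx).2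
      rw [Finset.card_range] at this
      exact_mod_cast this
    calc _ ≤ X * (κ * z / (2 * X)) := by gcongr
      _ = _ := by field_simp
  have hs3 : ∑ x ∈ Finset.range (n + 1), (if X ≤ x then q ^ x else 0) ≤ 2 * q ^ X := by
    rw [← Finset.sum_filter]
    have hsub : ((Finset.range (n + 1)).filter fun x => X ≤ x) ⊆ Finset.Ico X (n + 1) := by
      intro x hx
      rw [Finset.mem_filter, Finset.mem_range] at hx
      exact Finset.mem_Ico.2 ⟨hx.2, hx.1⟩
    refine (Finset.sum_le_sum_of_subset_of_nonneg hsub fun x _ _ => by positivity).trans ?_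
    refine (geom_sum_Ico_le_of_lt_one hq0.le (by linarith)).trans ?_
    rw [div_le_iff₀ (by linarith)]
    have : 0 < q ^ X := by positivity
    nlinarith
  linarith

/-- Lower bound for the probability that the defect is small. -/
lemma one_le_hyperProb_defect_mul {n k r T X : ℕ} (hk : 2 ≤ k) (hn : 1 ≤ n) (hr : 0 < r)
    (hX : 0 < X) {p y h M A θ ξ q : ℝ} (h0 : 0 ≤ p) (h1 : p < 1)
    (hy : (1 - p)⁻¹ ≤ Real.exp y) (hh0 : 0 < h) (hh1 : h ≤ 1)
    (hT : (1 + h) * ((n : ℝ) / r) ≤ T) (hM : 2 * r / h ≤ M)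
    (hA : 0 ≤ A) (hθ : 0 ≤ θ) (hθ1 : θ ≤ 1) (hξ : 0 < ξ)
    (hexp : ∀ m ≤ T, y * (m.choose k : ℝ) ≤ A * m * ((m : ℝ) / T) ^ (k - 1))
    (hAξ : A * ξ ^ (k - 1) ≤ θ) (hAX : A * X ^ k ≤ (T : ℝ) ^ (k - 1))
    (hq : Real.exp A * Real.exp 1 / (ξ * r) ≤ q) (hq2 : q ≤ 1 / 2)
    (hqX : 4 * q ^ X ≤ θ * (n / r ^ 2))
    (hsmall : 2 * X ^ 2 * Real.exp 1 ≤ θ * (ξ * r)) :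
    1 ≤ hyperProb n k p (fun E => (defect r E : ℝ) ≤ M) *
      (4 * Real.exp 1 * n * Real.exp (3 * θ * n)) := by
  have hn' : (0 : ℝ) < n := by exact_mod_cast hn
  have hr' : (0 : ℝ) < r := by exact_mod_cast hr
  have hX1 : (1 : ℝ) ≤ X := by exact_mod_cast hX
  have hTs : (n : ℝ) / r ≤ T := by
    have : 0 < (n : ℝ) / r := by positivity
    nlinarith
  have hT' : (0 : ℝ) < T := lt_of_lt_of_le (by positivity) hTs
  set z : ℝ := n / r ^ 2 with hzdef
  have hz : 0 < z := by positivity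
  have hzT : z ≤ T / r := by
    calc z = n / r / r := by rw [hzdef]; field_simp
      _ ≤ _ := by gcongr
  have hΦ := sum_truncated_le (n := n) hk (by exact_mod_cast hT') hX hz hA hθ hξ hθ hexp hAξ hAX
    (q := q) (le_trans ?_ hq) hq2 hqX ?_
  · set Φ := ∑ x ∈ Finset.range (n + 1),
      Real.exp (y * ((min x T).choose k : ℝ)) * z ^ x / x.factorial with hΦdef
    have hΦ0 : 0 ≤ Φ := Finset.sum_nonneg fun x _ => by positivity
    have hΦ1 : Φ ≤ Real.exp (z * (1 + 3 * θ)) := by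
      have he : Real.exp θ ≤ 1 + 2 * θ := by
        have := Real.abs_exp_sub_one_sub_id_le (abs_le.2 ⟨by linarith, hθ1⟩)
        nlinarith [(abs_le.1 this).2]
      have h2 : Real.exp (z * Real.exp θ) ≤ Real.exp (z * (1 + 2 * θ)) := by gcongr
      have h3 : 1 ≤ Real.exp (z * (1 + 2 * θ)) := Real.one_le_exp (by positivity)
      have h4 := Real.add_one_le_exp (θ * z)
      have h5 : 0 ≤ θ * z := by positivity
      calc Φ ≤ Real.exp (z * (1 + 2 * θ)) * (θ * z + 1) := by nlinarith
        _ ≤ Real.exp (z * (1 + 2 * θ)) * Real.exp (θ * z) := by gcongr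
        _ = _ := by rw [← Real.exp_add]; ring_nf
    have hΦ2 : Φ ^ (r * r) ≤ Real.exp n * Real.exp (3 * θ * n) := by
      calc _ ≤ Real.exp (z * (1 + 3 * θ)) ^ (r * r) := by gcongr
        _ = _ := by
          rw [← Real.exp_nat_mul, ← Real.exp_add, hzdef]
          congr 1
          push_cast
          field_simp
    have hgood := half_le_card_few_dropped hr hh0 hh1 hT hM
    have hsm := sq_card_le_hyperProb_defect_mul (k := k) (T := T) (M := M) (by omega) h0 h1 hy hz
      (Finset.univ.filter fun c : Fin n → Fin r => ((∑ i, (fiberCard c i - T) : ℕ) : ℝ) ≤ M)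
      fun c hc => (Finset.mem_filter.1 hc).2
    set P := hyperProb n k p (fun E => (defect r E : ℝ) ≤ M) with hP
    have hP0 : 0 ≤ P := by
      rw [hP, hyperProb_eq_subsetExp, ← subsetExp_const p
        ((Finset.univ : Finset (Fin n)).powersetCard k) 0]
      exact subsetExp_mono h0 h1.le fun E _ => ind_nonneg _
    have hchain : (n : ℝ) ^ n / 4 ≤ P * (4 * Real.exp 1 * n * Real.exp (3 * θ * n)) *
        ((n : ℝ) ^ n / 4) := by
      calc (n : ℝ) ^ n / 4 = ((r : ℝ) ^ n / 2) ^ 2 * z ^ n := by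
            rw [hzdef, div_pow _ ((r : ℝ) ^ 2), ← pow_mul, mul_comm 2 n, pow_mul]
            field_simp
            norm_num
        _ ≤ P * (n.factorial * Φ ^ (r * r)) := by
            refine le_trans ?_ hsm
            gcongr
        _ ≤ P * (n.factorial * (Real.exp n * Real.exp (3 * θ * n))) := by gcongr
        _ = P * ((n.factorial * Real.exp n) * Real.exp (3 * θ * n)) := by ring
        _ ≤ P * ((Real.exp 1 * n * (n : ℝ) ^ n) * Real.exp (3 * θ * n)) := by
            have := factorial_mul_exp_le hn
            gcongr
        _ = _ := by ring
    have hpos : 0 < (n : ℝ) ^ n / 4 := by positivity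
    exact le_of_mul_le_mul_right (by linarith) hpos
  · rw [div_le_div_iff₀ (by positivity) (by positivity)]
    have := (le_div_iff₀ hr').1 hzT
    calc Real.exp A * Real.exp 1 * z * (ξ * r) = Real.exp A * Real.exp 1 * ξ * (z * r) := by ring
      _ ≤ Real.exp A * Real.exp 1 * ξ * T := by gcongr
      _ = _ := by ring
  · intro hs
    have hzX : z * (ξ * r) ≤ X := by
      calc z * (ξ * r) = ξ * (z * r) := by ring
        _ ≤ ξ * T := mul_le_mul_of_nonneg_left ((le_div_iff₀ hr').1 hzT) hξ.le
        _ ≤ X := hs.le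
    have hξr : 0 < ξ * r := by positivity
    have he := Real.add_one_le_exp (1 : ℝ)
    have hmain : 2 * X * Real.exp 1 * z ≤ θ := by
      have : 2 * X * Real.exp 1 * z * (ξ * r) ≤ θ * (ξ * r) := by
        calc _ = 2 * X * Real.exp 1 * (z * (ξ * r)) := by ring
          _ ≤ 2 * X * Real.exp 1 * X := by gcongr
          _ = 2 * X ^ 2 * Real.exp 1 := by ring
          _ ≤ _ := hsmall
      exact le_of_mul_le_mul_right this hξr
    refine ⟨?_, hmain⟩
    have h2X : (1 : ℝ) ≤ 2 * X * Real.exp 1 :=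
      one_le_mul_of_one_le_of_one_le (by linarith) (by linarith)
    exact (le_mul_of_one_le_left hz.le h2X).trans (hmain.trans hθ1)

end Moments

section Combination

lemma hyperProb_le_one {n k : ℕ} {p : ℝ} (h0 : 0 ≤ p) (h1 : p ≤ 1)
    (P : Finset (Finset (Fin n)) → Prop) : hyperProb n k p P ≤ 1 := by
  rw [hyperProb_eq_subsetExp,
    ← subsetExp_const p ((Finset.univ : Finset (Fin n)).powersetCard k) 1]
  exact subsetExp_mono h0 h1 fun E _ => ind_le_one _

lemma hyperProb_nonneg {n k : ℕ} {p : ℝ} (h0 : 0 ≤ p) (h1 : p ≤ 1)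
    (P : Finset (Finset (Fin n)) → Prop) : 0 ≤ hyperProb n k p P := by
  rw [hyperProb_eq_subsetExp,
    ← subsetExp_const p ((Finset.univ : Finset (Fin n)).powersetCard k) 0]
  exact subsetExp_mono h0 h1 fun E _ => ind_nonneg _

lemma one_le_hyperProb_add_add {n k : ℕ} {p : ℝ} (h0 : 0 ≤ p) (h1 : p ≤ 1)
    {P Q R : Finset (Finset (Fin n)) → Prop}
    (h : ∀ E ⊆ (Finset.univ : Finset (Fin n)).powersetCard k, P E ∨ Q E ∨ R E) :
    1 ≤ hyperProb n k p P + hyperProb n k p Q + hyperProb n k p R := by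
  simp_rw [hyperProb_eq_subsetExp]
  rw [← subsetExp_add, ← subsetExp_add,
    ← subsetExp_const p ((Finset.univ : Finset (Fin n)).powersetCard k) 1]
  refine subsetExp_mono h0 h1 fun E hE => ?_
  have hP := ind_nonneg (P E)
  have hQ := ind_nonneg (Q E)
  have hR := ind_nonneg (R E)
  rcases h E hE with h | h | h <;> rw [ind_true h] <;> linarith

/-- A small vertex set of a hypergraph without dense spots can be coloured with few colours. -/
lemma colorableOn_of_not_dense {n k a t m : ℕ} (hk : 3 ≤ k) (hn : 0 < n)
    {E : Finset (Finset (Fin n))} (hE : ∀ e ∈ E, e.card = k) {D b : ℝ} (hD : 0 < D) (hb : 1 ≤ b)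
    (hdens : ∀ U : Finset (Fin n), U.Nonempty →
      ((edgesIn E U).card : ℝ) < densityBound n k D b U.card * U.card)
    (ha : 0 < a) (haD : 2 * Real.exp 2 * D * (2 * a / n) ^ (k - 1) ≤ 1) (ht : k * b ≤ t)
    {S : Finset (Fin n)} (hS : S.card ≤ m * a) : ColorableOn E S (m + t) := by
  have hn' : (0 : ℝ) < n := by exact_mod_cast hn
  have ha' : (0 : ℝ) < a := by exact_mod_cast ha
  have hne : ∀ e ∈ E, e.Nonempty := fun e he => Finset.card_pos.1 (by rw [hE e he]; omega)
  have he2 : (1 : ℝ) ≤ Real.exp 2 := Real.one_le_exp (by norm_num)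
  refine colorableOn_of_extraction hne ha m S hS fun U _ => ?_
  by_cases hU : Real.exp 2 * D * ((U.card : ℝ) / n) ^ (k - 1) ≤ b
  · left
    refine colorableOn_of_sparse (by omega) hE U fun W hW hWne => ?_
    have h1 := hdens W hWne
    have h2 : densityBound n k D b W.card = b := by
      refine max_eq_right (le_trans ?_ hU)
      have : W.card ≤ U.card := Finset.card_le_card hW
      gcongr
    rw [h2] at h1
    have hk0 : (0 : ℝ) < k := by exact_mod_cast (by omega : 0 < k)
    have h3 : (k : ℝ) * (edgesIn E W).card < t * W.card := by
      calc (k : ℝ) * (edgesIn E W).card < k * (b * W.card) := by gcongr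
        _ = k * b * W.card := by ring
        _ ≤ t * W.card := by gcongr
    exact_mod_cast h3
  · right
    rw [not_le] at hU
    have hpos : 0 < U.card := by
      rcases Nat.eq_zero_or_pos U.card with h | h
      · rw [h, Nat.cast_zero, zero_div, zero_pow (by omega), mul_zero] at hU
        linarith
      · exact h
    have h2a : 2 * a ≤ U.card := by
      by_contra hcon
      have h3 : (U.card : ℝ) ≤ 2 * a := by exact_mod_cast (not_le.1 hcon).le
      have h4 : Real.exp 2 * D * ((U.card : ℝ) / n) ^ (k - 1) ≤
          Real.exp 2 * D * (2 * a / n) ^ (k - 1) := by gcongr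
      have h5 : 0 ≤ Real.exp 2 * D * (2 * a / n) ^ (k - 1) := by positivity
      linarith
    refine exists_independent (by omega) hE U h2a ?_
    have h1 := hdens U (Finset.card_pos.1 hpos)
    rw [densityBound, max_eq_left hU.le] at h1
    have hu : (0 : ℝ) < U.card := by exact_mod_cast hpos
    have hkk : ∀ x : ℝ, x ^ k = x ^ (k - 1) * x := fun x => by
      rw [← pow_succ, Nat.sub_add_cancel (by omega)]
    have h3 : ((edgesIn E U).card : ℝ) * (2 * a) ^ k ≤ a * (U.card : ℝ) ^ k := by
      calc ((edgesIn E U).card : ℝ) * (2 * a) ^ k ≤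
            Real.exp 2 * D * ((U.card : ℝ) / n) ^ (k - 1) * U.card * (2 * a) ^ k := by gcongr
        _ = 2 * Real.exp 2 * D * (2 * a / n) ^ (k - 1) * (a * (U.card : ℝ) ^ k) := by
            rw [hkk (2 * a), hkk (U.card : ℝ), div_pow, div_pow]
            ring
        _ ≤ 1 * (a * (U.card : ℝ) ^ k) := by gcongr
        _ = _ := one_mul _
    exact_mod_cast h3

/-- Colourability from small defect and absence of dense spots. -/
lemma one_le_hyperProb_rColorable_add {n k r a t m : ℕ} (hk : 3 ≤ k) (hn : 0 < n) {p D b : ℝ}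
    (h0 : 0 ≤ p) (h1 : p ≤ 1) (hD : 0 < D) (hb : 1 ≤ b)
    (hDb : Real.exp (3 - b) * D ≤ 1 / 4) (hp : p * (n.choose k) ≤ D * n)
    (ha : 0 < a) (haD : 2 * Real.exp 2 * D * (2 * a / n) ^ (k - 1) ≤ 1) (ht : k * b ≤ t) :
    1 ≤ hyperProb n k p (RColorable (r + (m + t))) + 1 / n +
      hyperProb n k p (fun E => ((m * a : ℕ) : ℝ) ≤ (defect r E : ℝ)) := by
  have hdense := hyperProb_dense_le hk hn h0 h1 hD hb hDb hp
  have hall := one_le_hyperProb_add_add (k := k) h0 h1 (n := n) (P := RColorable (r + (m + t)))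
    (Q := fun E => ∃ U : Finset (Fin n), U.Nonempty ∧
      densityBound n k D b U.card * U.card ≤ ((edgesIn E U).card : ℝ))
    (R := fun E => ((m * a : ℕ) : ℝ) ≤ (defect r E : ℝ)) ?_
  · linarith
  · intro E hE
    by_cases hQ : ∃ U : Finset (Fin n), U.Nonempty ∧
      densityBound n k D b U.card * U.card ≤ ((edgesIn E U).card : ℝ)
    · exact Or.inr (Or.inl hQ)
    by_cases hR : ((m * a : ℕ) : ℝ) ≤ (defect r E : ℝ)
    · exact Or.inr (Or.inr hR)
    left
    push Not at hQ
    have hEk : ∀ e ∈ E, e.card = k := fun e he => (Finset.mem_powersetCard.1 (hE he)).2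
    have hne : ∀ e ∈ E, e.Nonempty := fun e he => Finset.card_pos.1 (by rw [hEk e he]; omega)
    obtain ⟨W, hW, hcol⟩ := exists_of_defect (r := r) hne
    have hWm : W.card ≤ m * a := by
      rw [hW]
      exact_mod_cast (not_le.1 hR).le
    have hcol2 := colorableOn_of_not_dense hk hn hEk hD hb hQ ha haD ht hWm
    have := hcol.union hne hcol2
    rw [Finset.sdiff_union_of_subset (Finset.subset_univ W)] at this
    exact this.rColorable

end Combination

section Parameters

lemma inv_one_sub_le_exp {p ζ : ℝ} (h0 : 0 ≤ p) (hζ1 : ζ ≤ 1) (hp : p ≤ ζ / 2) :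
    (1 - p)⁻¹ ≤ Real.exp ((1 + ζ) * p) := by
  have h1 : 0 < 1 - p := by linarith
  have h2 : (1 - p)⁻¹ ≤ 1 + (1 + ζ) * p := by
    rw [inv_le_iff_one_le_mul₀ h1]
    have h3 : 0 ≤ ζ - (1 + ζ) * p := by nlinarith
    nlinarith [mul_nonneg h0 h3]
  have := Real.add_one_le_exp ((1 + ζ) * p)
  linarith

lemma edgeProb_mul_choose_le {n k r m T : ℕ} {ε ζ : ℝ} (hk : 1 ≤ k) (hkn : k ≤ n) (hr : 0 < r)
    (hε1 : ε < 1) (hζ : 0 < ζ) (hεζ : (1 + ζ) ^ k * (1 - ε) ≤ 1 - ε / 2)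
    (hT0 : 0 < T) (hT : (T : ℝ) ≤ (1 + ζ) * ((n : ℝ) / r)) (hm : m ≤ n) :
    (1 + ζ) * ((1 - ε) * (r : ℝ) ^ (k - 1) * Real.log r * ((n : ℝ) / (n.choose k : ℝ))) *
      (m.choose k : ℝ) ≤ (1 - ε / 2) * Real.log r * m * ((m : ℝ) / T) ^ (k - 1) := by
  have hn : (0 : ℝ) < n := by exact_mod_cast (by omega : 0 < n)
  have hr' : (0 : ℝ) < r := by exact_mod_cast hr
  have hT' : (0 : ℝ) < T := by exact_mod_cast hT0
  have hC : (0 : ℝ) < n.choose k := by exact_mod_cast Nat.choose_pos hkn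
  have hch : (m.choose k : ℝ) * (n : ℝ) ^ k ≤ n.choose k * (m : ℝ) ^ k := by
    exact_mod_cast choose_mul_pow_le k hm
  have hch2 : (n : ℝ) / n.choose k * m.choose k ≤ m * ((m : ℝ) / n) ^ (k - 1) := by
    have hkk : ∀ x : ℝ, x ^ k = x ^ (k - 1) * x := fun x => by
      rw [← pow_succ, Nat.sub_add_cancel hk]
    rw [hkk, hkk] at hch
    rw [div_pow, div_mul_eq_mul_div, mul_div_assoc', div_le_div_iff₀ hC (by positivity)]
    calc (n : ℝ) * m.choose k * n ^ (k - 1) = m.choose k * ((n : ℝ) ^ (k - 1) * n) := by ring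
      _ ≤ _ := hch
      _ = _ := by ring
  have hrm : (r : ℝ) * (m / n) ≤ (1 + ζ) * (m / T) := by
    rw [mul_div_assoc', mul_div_assoc', div_le_div_iff₀ hn hT']
    have := mul_le_mul_of_nonneg_left hT (show 0 ≤ (r : ℝ) * m by positivity)
    calc (r : ℝ) * m * T ≤ _ := this
      _ = _ := by field_simp
  have hε' : 0 < 1 - ε := by linarith
  calc _ = (1 + ζ) * (1 - ε) * (r : ℝ) ^ (k - 1) * Real.log r *
        ((n : ℝ) / n.choose k * m.choose k) := by ring
    _ ≤ (1 + ζ) * (1 - ε) * (r : ℝ) ^ (k - 1) * Real.log r * (m * ((m : ℝ) / n) ^ (k - 1)) := by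
        gcongr
    _ = (1 + ζ) * (1 - ε) * Real.log r * m * ((r : ℝ) * (m / n)) ^ (k - 1) := by
        rw [mul_pow]; ring
    _ ≤ (1 + ζ) * (1 - ε) * Real.log r * m * ((1 + ζ) * (m / T)) ^ (k - 1) := by gcongr
    _ = ((1 + ζ) ^ (k - 1) * (1 + ζ)) * (1 - ε) * (Real.log r * m * ((m : ℝ) / T) ^ (k - 1)) := by
        rw [mul_pow]; ring
    _ = (1 + ζ) ^ k * (1 - ε) * (Real.log r * m * ((m : ℝ) / T) ^ (k - 1)) := by
        rw [← pow_succ, Nat.sub_add_cancel hk]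
    _ ≤ (1 - ε / 2) * (Real.log r * m * ((m : ℝ) / T) ^ (k - 1)) := by gcongr
    _ = _ := by ring

lemma edgeProb_le {n k r : ℕ} {ε K l : ℝ} (hk : 2 ≤ k) (hkn : k ≤ n) (hr : 0 < r)
    (hε0 : 0 < ε) (hl : l ^ (k - 1) = Real.log r) (hl0 : 0 < l)
    (hK : 1 ≤ K) (hs : K * l ≤ (n : ℝ) / r) :
    (1 - ε) * (r : ℝ) ^ (k - 1) * Real.log r * ((n : ℝ) / (n.choose k : ℝ)) ≤ (k : ℝ) ^ k / K := by
  have hn : (0 : ℝ) < n := by exact_mod_cast (by omega : 0 < n)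
  have hr' : (0 : ℝ) < r := by exact_mod_cast hr
  have hC : (0 : ℝ) < n.choose k := by exact_mod_cast Nat.choose_pos hkn
  have hch : (n : ℝ) ^ k ≤ n.choose k * (k : ℝ) ^ k := by
    have := choose_mul_pow_le k hkn
    rw [Nat.choose_self, one_mul] at this
    exact_mod_cast this
  have hK1 : K ≤ K ^ (k - 1) := le_self_pow₀ hK (by omega)
  have hs1 : K * (Real.log r * (r : ℝ) ^ (k - 1)) ≤ (n : ℝ) ^ (k - 1) := by
    rw [le_div_iff₀ hr'] at hs
    calc K * (Real.log r * (r : ℝ) ^ (k - 1)) ≤ K ^ (k - 1) * (l ^ (k - 1) * (r : ℝ) ^ (k - 1)) := by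
          rw [hl]; gcongr
      _ = (K * l * r) ^ (k - 1) := by rw [mul_pow, mul_pow]; ring
      _ ≤ _ := by gcongr
  have h1 : (1 - ε) * (r : ℝ) ^ (k - 1) * Real.log r ≤ (r : ℝ) ^ (k - 1) * Real.log r := by
    have : 0 ≤ (r : ℝ) ^ (k - 1) * Real.log r := by positivity
    nlinarith
  have hK0 : 0 < K := by linarith
  calc _ ≤ (r : ℝ) ^ (k - 1) * Real.log r * ((n : ℝ) / (n.choose k : ℝ)) := by gcongr
    _ ≤ (k : ℝ) ^ k / K := by
      rw [mul_div_assoc', div_le_div_iff₀ hC hK0]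
      calc (r : ℝ) ^ (k - 1) * Real.log r * n * K = K * (Real.log r * (r : ℝ) ^ (k - 1)) * n := by
            ring
        _ ≤ (n : ℝ) ^ (k - 1) * n := by gcongr
        _ = (n : ℝ) ^ k := by rw [← pow_succ, Nat.sub_add_cancel (by omega)]
        _ ≤ _ := hch.trans_eq (mul_comm _ _)

end Parameters

section Asymptotics

lemma le_of_mul_le_div {n k r : ℕ} {K l : ℝ} (hr : 0 < r) (hl1 : 1 ≤ l) (hK : (k : ℝ) ≤ K)
    (hs : K * l ≤ (n : ℝ) / r) : k ≤ n := by
  have hr' : (0 : ℝ) < r := by exact_mod_cast hr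
  have hr1 : (1 : ℝ) ≤ r := by exact_mod_cast hr
  have hK0 : 0 ≤ K := (Nat.cast_nonneg k).trans hK
  have h1 : K * r ≤ n :=
    (le_div_iff₀ hr').1 ((le_mul_of_one_le_right hK0 hl1).trans hs)
  have h2 : (k : ℝ) ≤ n := (hK.trans (le_mul_of_one_le_right hK0 hr1)).trans h1
  exact_mod_cast h2

set_option maxHeartbeats 2000000 in
lemma one_le_hyperProb_defect_mul_of_params {n k r t a X : ℕ} {ε ζ η K l : ℝ} (hk : 3 ≤ k)
    (hε0 : 0 < ε) (hε1 : ε < 1) (hζ0 : 0 < ζ) (hζ1 : ζ ≤ 1) (hη : η = ζ / 8)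
    (hεζ : (1 + ζ) ^ k * (1 - ε) ≤ 1 - ε / 2) (hX : 0 < X) (hXε : 16 ≤ ε * X)
    (hl1 : 1 ≤ l) (hl : l ^ (k - 1) = Real.log r)
    (hK1 : 256 / η ^ 2 ≤ K) (hK2 : 2 / ζ ≤ K) (hK3 : (X : ℝ) ^ k ≤ K)
    (hK4 : 2 * (k : ℝ) ^ k / ζ ≤ K) (hK5 : (k : ℝ) ≤ K) (hs : K * l ≤ (n : ℝ) / r)
    (ht1 : η * r / 2 ≤ t) (ht2 : t ≤ η * r) (ha : (n : ℝ) / r / (16 * l) ≤ a)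
    (hrl : 2 ^ 38 * (X : ℝ) ^ 2 / η ^ 4 * l ^ 5 ≤ (r : ℝ) ^ (ε / 4)) :
    1 ≤ hyperProb n k
        ((1 - ε) * (r : ℝ) ^ (k - 1) * Real.log r * ((n : ℝ) / (n.choose k : ℝ)))
        (fun E => (defect (r - 2 * t) E : ℝ) ≤ ((t * a : ℕ) : ℝ) / 2) *
      (4 * Real.exp 1 * n * Real.exp (3 * (η ^ 2 / (2 ^ 17 * l ^ 2)) * n)) := by
  have hl0 : 0 < l := by linarith
  have hη0 : 0 < η := by rw [hη]; positivity
  have hη1 : η ≤ 1 / 8 := by rw [hη]; linarith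
  have hlog : 1 ≤ Real.log r := by rw [← hl]; exact one_le_pow₀ hl1
  have hr : 0 < r := by
    rcases Nat.eq_zero_or_pos r with h | h
    · rw [h] at hlog; norm_num at hlog
    · exact h
  have hr' : (0 : ℝ) < r := by exact_mod_cast hr
  have hr1 : (1 : ℝ) ≤ r := by exact_mod_cast hr
  have hk1 : (1 : ℝ) ≤ k := by exact_mod_cast (by omega : 1 ≤ k)
  have hK0 : 1 ≤ K := hk1.trans hK5
  have hKs : K ≤ (n : ℝ) / r := (le_mul_of_one_le_right (by linarith) hl1).trans hs
  have hs0 : 0 < (n : ℝ) / r := by linarith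
  have hrn : (r : ℝ) ≤ n := by
    have := hK0.trans hKs
    rwa [one_le_div hr'] at this
  have hn' : (0 : ℝ) < n := hr'.trans_le hrn
  have hkn : k ≤ n := le_of_mul_le_div hr hl1 hK5 hs
  have hX1 : (1 : ℝ) ≤ X := by exact_mod_cast hX
  have hηr : η * r ≤ 1 / 8 * r := by gcongr
  have h2t : 2 * t ≤ r := by
    have : (2 : ℝ) * t ≤ r := by linarith
    exact_mod_cast this
  set r₁ := r - 2 * t with hr₁
  have hr₁c : (r₁ : ℝ) = r - 2 * t := by rw [hr₁, Nat.cast_sub h2t]; push_cast; ring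
  have hr₁lo : (1 - 2 * η) * r ≤ r₁ := by rw [hr₁c]; linarith
  have hr₁half : (r : ℝ) / 2 ≤ r₁ := by linarith
  have hr₁le : (r₁ : ℝ) ≤ r := by rw [hr₁c]; linarith [Nat.cast_nonneg (α := ℝ) t]
  have hr₁0 : (0 : ℝ) < r₁ := by linarith
  set p := (1 - ε) * (r : ℝ) ^ (k - 1) * Real.log r * ((n : ℝ) / (n.choose k : ℝ)) with hp
  have hp0 : 0 ≤ p := by
    have : 0 ≤ 1 - ε := by linarith
    positivity
  have hpζ : p ≤ ζ / 2 := by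
    refine (edgeProb_le (by omega) hkn hr hε0 hl hl0 hK0 hs).trans ?_
    rw [div_le_iff₀ hζ0] at hK4
    rw [div_le_div_iff₀ (by linarith) (by norm_num)]
    linarith
  set T := ⌈(1 + η) * ((n : ℝ) / r₁)⌉₊ with hT
  have hT1 : (1 + η) * ((n : ℝ) / r₁) ≤ T := Nat.le_ceil _
  have hsT : (n : ℝ) / r ≤ T := by
    have h1 : (n : ℝ) / r ≤ n / r₁ := by gcongr
    have h2 : 0 < (n : ℝ) / r₁ := by positivity
    exact h1.trans ((le_mul_of_one_le_left h2.le (by linarith)).trans hT1)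
  have hT2 : (T : ℝ) ≤ (1 + ζ) * ((n : ℝ) / r) := by
    have h1 : (T : ℝ) < (1 + η) * ((n : ℝ) / r₁) + 1 := Nat.ceil_lt_add_one (by positivity)
    have h2 : (1 + η) * ((n : ℝ) / r₁) ≤ (1 + ζ / 2) * ((n : ℝ) / r) := by
      rw [mul_div_assoc', mul_div_assoc', div_le_div_iff₀ hr₁0 hr']
      have h3 : (1 + η) * r ≤ (1 + ζ / 2) * r₁ := by
        have h4 : (1 + η) ≤ (1 + ζ / 2) * (1 - 2 * η) := by
          have h5 : ζ * ζ ≤ ζ * 1 := by gcongr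
          have h6 : (1 + ζ / 2) * (1 - 2 * η) = 1 + ζ / 4 - ζ * ζ / 8 := by rw [hη]; ring
          linarith
        calc (1 + η) * r ≤ (1 + ζ / 2) * (1 - 2 * η) * r := by gcongr
          _ = (1 + ζ / 2) * ((1 - 2 * η) * r) := by ring
          _ ≤ _ := by gcongr
      calc (1 + η) * n * r = n * ((1 + η) * r) := by ring
        _ ≤ n * ((1 + ζ / 2) * r₁) := by gcongr
        _ = _ := by ring
    have h3 : 1 ≤ ζ / 2 * ((n : ℝ) / r) := by
      have := hK2.trans hKs
      rw [div_le_iff₀ hζ0] at this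
      linarith
    linarith
  have hT0 : (0 : ℝ) < T := hs0.trans_le hsT
  set θ := η ^ 2 / (2 ^ 17 * l ^ 2) with hθ
  have hθ0 : 0 < θ := by positivity
  have hθ1 : θ ≤ 1 := by
    rw [hθ, div_le_one (by positivity)]
    have h1 : η ^ 2 ≤ 1 := pow_le_one₀ hη0.le (by linarith)
    have h2 : 1 ≤ l ^ 2 := one_le_pow₀ hl1
    linarith
  have hQ : (r : ℝ) ^ (ε / 4) ≤ r := by
    calc (r : ℝ) ^ (ε / 4) ≤ (r : ℝ) ^ (1 : ℝ) :=
          Real.rpow_le_rpow_of_exponent_le hr1 (by linarith)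
      _ = r := Real.rpow_one _
  have hη4 : η ^ 4 ≤ 1 := pow_le_one₀ hη0.le (by linarith)
  have he := Real.exp_one_lt_d9
  have hQ0 : 0 < (r : ℝ) ^ (ε / 4) := by positivity
  have hbase : 2 ^ 38 * (X : ℝ) ^ 2 * l ^ 5 ≤ η ^ 4 * (r : ℝ) ^ (ε / 4) := by
    rw [div_mul_eq_mul_div, div_le_iff₀ (by positivity)] at hrl
    linarith
  have hX2 : (1 : ℝ) ≤ (X : ℝ) ^ 2 := one_le_pow₀ hX1
  have hl5 : (1 : ℝ) ≤ l ^ 5 := one_le_pow₀ hl1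
  have hbase' : 2 ^ 38 * l ^ 5 ≤ η ^ 4 * (r : ℝ) ^ (ε / 4) := by
    refine le_trans ?_ hbase
    rw [mul_right_comm]
    exact le_mul_of_one_le_right (by positivity) hX2
  have hbase2 : 2 ^ 38 * l ^ 5 ≤ η ^ 2 * (r : ℝ) ^ (ε / 4) := by
    refine hbase'.trans ?_
    have : η ^ 4 ≤ η ^ 2 := pow_le_pow_of_le_one hη0.le (by linarith) (by norm_num)
    gcongr
  refine one_le_hyperProb_defect_mul (T := T) (X := X) (h := η) (A := (1 - ε / 2) * Real.log r)
    (ξ := θ / l) (q := (r : ℝ) ^ (-(ε / 4))) (y := (1 + ζ) * p) (by omega)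
    (by omega) (by exact_mod_cast hr₁0) hX hp0 (by linarith)
    (inv_one_sub_le_exp hp0 hζ1 hpζ) hη0 (by linarith) hT1 ?_ ?_ hθ0.le hθ1 (by positivity)
    ?_ ?_ ?_ ?_ ?_ ?_ ?_
  · push_cast
    rw [div_le_iff₀ hη0]
    have h1 : η * r / 2 * ((n : ℝ) / r / (16 * l)) ≤ t * a := by gcongr
    have h2 : η * r / 2 * ((n : ℝ) / r / (16 * l)) * η = r * (η ^ 2 * ((n : ℝ) / r) / (32 * l)) := by
      ring
    have h3 : 8 ≤ η ^ 2 * ((n : ℝ) / r) / (32 * l) := by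
      rw [le_div_iff₀ (by positivity)]
      rw [div_le_iff₀ (by positivity)] at hK1
      calc 8 * (32 * l) = 256 * l := by ring
        _ ≤ K * η ^ 2 * l := by gcongr
        _ = η ^ 2 * (K * l) := by ring
        _ ≤ _ := by gcongr
    have h4 : r * 8 ≤ (t * a : ℝ) * η := by
      calc (r : ℝ) * 8 ≤ r * (η ^ 2 * ((n : ℝ) / r) / (32 * l)) := by gcongr
        _ = _ := h2.symm
        _ ≤ _ := by gcongr
    linarith
  · have : 0 ≤ 1 - ε / 2 := by linarith
    positivity
  · intro m hmT
    by_cases hmn : m ≤ n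
    · exact edgeProb_mul_choose_le (by omega) hkn hr hε1 hζ0 hεζ (by exact_mod_cast hT0) hT2 hmn
    · exfalso
      have h1 : (T : ℝ) ≤ n := by
        refine hT2.trans ?_
        rw [mul_div_assoc', div_le_iff₀ hr']
        have h8 : (8 : ℝ) ≤ r := by
          have : η ^ 4 * (r : ℝ) ^ (ε / 4) ≤ 1 * r := by gcongr
          linarith
        rw [mul_comm (n : ℝ)]
        gcongr
        linarith
      have : T ≤ n := by exact_mod_cast h1
      omega
  · rw [div_pow, hl, mul_div_assoc', div_le_iff₀ (by linarith)]
    have h1 : θ ^ (k - 1) ≤ θ := by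
      calc θ ^ (k - 1) ≤ θ ^ 1 := pow_le_pow_of_le_one hθ0.le hθ1 (by omega)
        _ = θ := pow_one _
    calc (1 - ε / 2) * Real.log r * θ ^ (k - 1) ≤ 1 * Real.log r * θ := by
          gcongr
          linarith
      _ = _ := by ring
  · calc (1 - ε / 2) * Real.log r * (X : ℝ) ^ k ≤ 1 * Real.log r * K := by
          gcongr
          linarith
      _ = K * l ^ (k - 1) := by rw [hl]; ring
      _ ≤ K ^ (k - 1) * l ^ (k - 1) := by
          gcongr
          exact le_self_pow₀ hK0 (by omega)
      _ = (K * l) ^ (k - 1) := (mul_pow _ _ _).symm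
      _ ≤ _ := by
          have := hs.trans hsT
          gcongr
  · have h1 : Real.exp ((1 - ε / 2) * Real.log r) =
        r * (r : ℝ) ^ (-(ε / 4)) * (r : ℝ) ^ (-(ε / 4)) := by
      rw [mul_assoc, ← Real.rpow_add hr', mul_comm, Real.exp_mul, Real.exp_log hr']
      nth_rewrite 2 [← Real.rpow_one (r : ℝ)]
      rw [← Real.rpow_add hr']
      congr 1
      ring
    have h2 : (r : ℝ) ^ (-(ε / 4)) * (r : ℝ) ^ (ε / 4) = 1 := by
      rw [← Real.rpow_add hr']; simp
    set q := (r : ℝ) ^ (-(ε / 4)) with hq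
    have hq0 : 0 < q := by positivity
    rw [h1, div_le_iff₀ (by positivity)]
    have h3 : q * Real.exp 1 * 2 ≤ θ / l := by
      rw [hθ, div_div, le_div_iff₀ (by positivity)]
      calc q * Real.exp 1 * 2 * (2 ^ 17 * l ^ 2 * l) = q * (Real.exp 1 * 2 ^ 18 * l ^ 3) := by ring
        _ ≤ q * (2 ^ 38 * l ^ 5) := by
            have : l ^ 3 ≤ l ^ 5 := pow_le_pow_right₀ hl1 (by norm_num)
            gcongr
            linarith
        _ ≤ q * (η ^ 2 * (r : ℝ) ^ (ε / 4)) := by gcongr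
        _ = η ^ 2 * (q * (r : ℝ) ^ (ε / 4)) := by ring
        _ = η ^ 2 := by rw [h2, mul_one]
    calc r * q * q * Real.exp 1 = q * (q * Real.exp 1 * 2 * (r / 2)) := by ring
      _ ≤ q * (θ / l * r₁) := by gcongr
  · rw [Real.rpow_neg hr'.le, ← one_div]
    refine one_div_le_one_div_of_le (by norm_num) ?_
    have : η ^ 4 * (r : ℝ) ^ (ε / 4) ≤ 1 * (r : ℝ) ^ (ε / 4) := by gcongr
    linarith
  · have h1 : ((r : ℝ) ^ (-(ε / 4))) ^ X ≤ 1 / (r : ℝ) ^ 4 := by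
      rw [← Real.rpow_natCast, ← Real.rpow_mul hr'.le, one_div, ← Real.rpow_natCast,
        ← Real.rpow_neg hr'.le]
      refine Real.rpow_le_rpow_of_exponent_le hr1 ?_
      push_cast
      linarith
    have h2 : 4 * (2 ^ 17 * l ^ 2) ≤ η ^ 2 * r := by
      have h3 : l ^ 2 ≤ l ^ 5 := pow_le_pow_right₀ hl1 (by norm_num)
      have h4 : η ^ 2 * (r : ℝ) ^ (ε / 4) ≤ η ^ 2 * r := by gcongr
      linarith
    have h3 : 4 ≤ θ * r := by
      rw [hθ, div_mul_eq_mul_div, le_div_iff₀ (by positivity)]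
      exact h2
    calc 4 * ((r : ℝ) ^ (-(ε / 4))) ^ X ≤ θ * r * (1 / (r : ℝ) ^ 4) := by gcongr
      _ = θ * ((1 / r) * (1 / r ^ 2)) := by field_simp
      _ ≤ θ * (n * (1 / r₁ ^ 2)) := by
          have : 1 / (r : ℝ) ≤ n := by
            rw [div_le_iff₀ hr']
            exact one_le_mul_of_one_le_of_one_le (hr1.trans hrn) hr1
          gcongr
      _ = _ := by ring
  · have h1 : 2 ^ 36 * (X : ℝ) ^ 2 * Real.exp 1 * l ^ 5 ≤ η ^ 4 * r := by
      have h4 : η ^ 4 * (r : ℝ) ^ (ε / 4) ≤ η ^ 4 * r := by gcongr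
      calc 2 ^ 36 * (X : ℝ) ^ 2 * Real.exp 1 * l ^ 5 ≤ 2 ^ 36 * (X : ℝ) ^ 2 * 4 * l ^ 5 := by
            gcongr
            linarith
        _ = 2 ^ 38 * (X : ℝ) ^ 2 * l ^ 5 := by ring
        _ ≤ _ := hbase.trans h4
    have h2 : θ * (θ / l) = η ^ 4 / (2 ^ 34 * l ^ 5) := by
      rw [hθ]; field_simp
    calc 2 * (X : ℝ) ^ 2 * Real.exp 1 = 2 ^ 36 * (X : ℝ) ^ 2 * Real.exp 1 * l ^ 5 /
          (2 ^ 35 * l ^ 5) := by field_simp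
      _ ≤ η ^ 4 * r / (2 ^ 35 * l ^ 5) := by gcongr
      _ = θ * (θ / l) * (r / 2) := by rw [h2]; field_simp
      _ ≤ θ * (θ / l) * r₁ := by gcongr
      _ = _ := by ring

end Asymptotics

section Core

lemma edgeProb_nonneg {n k r : ℕ} {ε : ℝ} (hε1 : ε < 1) :
    0 ≤ (1 - ε) * (r : ℝ) ^ (k - 1) * Real.log r * ((n : ℝ) / (n.choose k : ℝ)) := by
  have : 0 ≤ 1 - ε := by linarith
  have := Real.log_natCast_nonneg r
  positivity

lemma edgeProb_le_one {n k r : ℕ} {ε ζ K l : ℝ} (hk : 2 ≤ k) (hkn : k ≤ n) (hr : 0 < r)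
    (hε0 : 0 < ε) (hζ0 : 0 < ζ) (hζ1 : ζ ≤ 1) (hl : l ^ (k - 1) = Real.log r) (hl0 : 0 < l)
    (hK1 : 1 ≤ K) (hK : 2 * (k : ℝ) ^ k / ζ ≤ K) (hs : K * l ≤ (n : ℝ) / r) :
    (1 - ε) * (r : ℝ) ^ (k - 1) * Real.log r * ((n : ℝ) / (n.choose k : ℝ)) ≤ 1 := by
  refine (edgeProb_le hk hkn hr hε0 hl hl0 hK1 hs).trans ?_
  rw [div_le_iff₀ hζ0] at hK
  rw [div_le_one (by linarith)]
  have : K * ζ ≤ K * 1 := by gcongr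
  have : 0 ≤ (k : ℝ) ^ k := by positivity
  linarith

lemma hyperProb_defect_ge_le {n k r t a : ℕ} {p η l : ℝ} (hk : 1 ≤ k) (hn : 0 < n)
    (h0 : 0 ≤ p) (h1 : p ≤ 1) (hl0 : 0 < l) (hta : η * n / (32 * l) ≤ ((t * a : ℕ) : ℝ))
    (hη0 : 0 < η)
    (hlow : 1 ≤ hyperProb n k p (fun E => (defect r E : ℝ) ≤ ((t * a : ℕ) : ℝ) / 2) *
      (4 * Real.exp 1 * n * Real.exp (3 * (η ^ 2 / (2 ^ 17 * l ^ 2)) * n))) :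
    hyperProb n k p (fun E => ((t * a : ℕ) : ℝ) ≤ (defect r E : ℝ)) ≤
      4 * Real.exp 1 * n * Real.exp (-(η ^ 2 / 2 ^ 15 * (n / l ^ 2))) := by
  have hn' : (0 : ℝ) < n := by exact_mod_cast hn
  set N : ℝ := ((t * a : ℕ) : ℝ) with hN
  have hN0 : 0 ≤ N := Nat.cast_nonneg _
  have hcon := defect_concentration (k := k) (r := r) hk hn h0 h1 (by linarith : N / 2 ≤ N)
  set P := hyperProb n k p (fun E => (defect r E : ℝ) ≤ N / 2)
  set Q := hyperProb n k p (fun E => N ≤ (defect r E : ℝ))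
  have hQ : 0 ≤ Q := hyperProb_nonneg h0 h1 _
  set B := 4 * Real.exp 1 * n with hB
  have hB0 : 0 < B := by positivity
  have hexp : -((N - N / 2) ^ 2 / (4 * n)) + 3 * (η ^ 2 / (2 ^ 17 * l ^ 2)) * n ≤
      -(η ^ 2 / 2 ^ 15 * (n / l ^ 2)) := by
    have h2 : (η * n / (32 * l)) ^ 2 / (16 * n) ≤ (N - N / 2) ^ 2 / (4 * n) := by
      have : (N - N / 2) ^ 2 / (4 * n) = N ^ 2 / (16 * n) := by ring
      rw [this]
      gcongr
    have h3 : (η * n / (32 * l)) ^ 2 / (16 * n) = 8 * (η ^ 2 * n / (2 ^ 17 * l ^ 2)) := by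
      field_simp; norm_num
    have h4 : 3 * (η ^ 2 / (2 ^ 17 * l ^ 2)) * n = 3 * (η ^ 2 * n / (2 ^ 17 * l ^ 2)) := by ring
    have h5 : η ^ 2 / 2 ^ 15 * (n / l ^ 2) = 4 * (η ^ 2 * n / (2 ^ 17 * l ^ 2)) := by
      field_simp; norm_num
    have h6 : 0 ≤ η ^ 2 * n / (2 ^ 17 * l ^ 2) := by positivity
    linarith
  calc Q ≤ P * (B * Real.exp (3 * (η ^ 2 / (2 ^ 17 * l ^ 2)) * n)) * Q :=
        le_mul_of_one_le_left hQ hlow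
    _ = B * (P * Q * Real.exp (3 * (η ^ 2 / (2 ^ 17 * l ^ 2)) * n)) := by ring
    _ ≤ B * (Real.exp (-((N - N / 2) ^ 2 / (4 * n))) *
          Real.exp (3 * (η ^ 2 / (2 ^ 17 * l ^ 2)) * n)) := by gcongr
    _ ≤ B * Real.exp (-(η ^ 2 / 2 ^ 15 * (n / l ^ 2))) := by
        rw [← Real.exp_add]
        gcongr

lemma one_le_hyperProb_rColorable_of_params {n k r X : ℕ} {ε ζ η K l : ℝ} (hk : 3 ≤ k)
    (hε0 : 0 < ε) (hε1 : ε < 1) (hζ0 : 0 < ζ) (hζ1 : ζ ≤ 1) (hη : η = ζ / 8)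
    (hεζ : (1 + ζ) ^ k * (1 - ε) ≤ 1 - ε / 2) (hX : 0 < X) (hXε : 16 ≤ ε * X)
    (hl1 : 1 ≤ l) (hl : l ^ (k - 1) = Real.log r)
    (hK1 : 256 / η ^ 2 ≤ K) (hK2 : 2 / ζ ≤ K) (hK3 : (X : ℝ) ^ k ≤ K)
    (hK4 : 2 * (k : ℝ) ^ k / ζ ≤ K) (hK5 : (k : ℝ) ≤ K) (hs : K * l ≤ (n : ℝ) / r)
    (hrk : 2 * k ≤ η * r) (hrexp : Real.exp (3 - η * r / (2 * k)) * (r : ℝ) ^ k ≤ 1 / 4)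
    (hrl : 2 ^ 38 * (X : ℝ) ^ 2 / η ^ 4 * l ^ 5 ≤ (r : ℝ) ^ (ε / 4)) :
    1 ≤ hyperProb n k
        ((1 - ε) * (r : ℝ) ^ (k - 1) * Real.log r * ((n : ℝ) / (n.choose k : ℝ)))
        (RColorable r) + 1 / n +
      4 * Real.exp 1 * n * Real.exp (-(η ^ 2 / 2 ^ 15 * (n / l ^ 2))) := by
  have hl0 : 0 < l := by linarith
  have hη0 : 0 < η := by rw [hη]; positivity
  have hη1 : η ≤ 1 / 8 := by rw [hη]; linarith
  have hlog : 1 ≤ Real.log r := by rw [← hl]; exact one_le_pow₀ hl1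
  have hk3 : (3 : ℝ) ≤ k := by exact_mod_cast hk
  have hr : 0 < r := by
    rcases Nat.eq_zero_or_pos r with h | h
    · rw [h] at hlog; norm_num at hlog
    · exact h
  have hr' : (0 : ℝ) < r := by exact_mod_cast hr
  have hr1 : (1 : ℝ) ≤ r := by exact_mod_cast hr
  have hK0 : 1 ≤ K := by linarith
  have hkn : k ≤ n := le_of_mul_le_div hr hl1 hK5 hs
  have hn : 0 < n := by omega
  have hn' : (0 : ℝ) < n := by exact_mod_cast hn
  set p := (1 - ε) * (r : ℝ) ^ (k - 1) * Real.log r * ((n : ℝ) / (n.choose k : ℝ)) with hp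
  have hp0 : 0 ≤ p := edgeProb_nonneg hε1
  have hp1 : p ≤ 1 := edgeProb_le_one (by omega) hkn hr hε0 hζ0 hζ1 hl hl0 hK0 hK4 hs
  set t := ⌊η * r⌋₊ with ht
  have ht2 : (t : ℝ) ≤ η * r := Nat.floor_le (by positivity)
  have ht1 : η * r / 2 ≤ t := by
    have := Nat.lt_floor_add_one (η * r)
    rw [← ht] at this
    linarith
  set a := ⌊(n : ℝ) / r / (8 * l)⌋₊ with ha
  have hK256 : 16 ≤ K := by
    refine le_trans ?_ hK1
    rw [le_div_iff₀ (by positivity)]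
    have : η ^ 2 ≤ 1 := pow_le_one₀ hη0.le (by linarith)
    linarith
  have has : 2 ≤ (n : ℝ) / r / (8 * l) := by
    rw [le_div_iff₀ (by positivity)]
    have : 16 * l ≤ K * l := by gcongr
    linarith
  have ha2 : (a : ℝ) ≤ (n : ℝ) / r / (8 * l) := Nat.floor_le (by linarith)
  have ha1 : (n : ℝ) / r / (16 * l) ≤ a := by
    have h1 := Nat.lt_floor_add_one ((n : ℝ) / r / (8 * l))
    rw [← ha] at h1
    have h2 : (n : ℝ) / r / (8 * l) = 2 * ((n : ℝ) / r / (16 * l)) := by field_simp; norm_num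
    linarith
  have ha0 : 0 < a := Nat.floor_pos.2 (by linarith)
  have h2t : 2 * t ≤ r := by
    have hηr : η * r ≤ 1 / 8 * r := by gcongr
    have : (2 : ℝ) * t ≤ r := by linarith
    exact_mod_cast this
  have hlow := one_le_hyperProb_defect_mul_of_params hk hε0 hε1 hζ0 hζ1 hη hεζ hX hXε hl1 hl hK1
    hK2 hK3 hK4 hK5 hs ht1 ht2 ha1 hrl
  have hta : η * n / (32 * l) ≤ ((t * a : ℕ) : ℝ) := by
    push_cast
    calc η * n / (32 * l) = η * r / 2 * ((n : ℝ) / r / (16 * l)) := by field_simp; norm_num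
      _ ≤ _ := by gcongr
  have hup := hyperProb_defect_ge_le (by omega) hn hp0 hp1 hl0 hta hη0 hlow
  have hD0 : 0 < (r : ℝ) ^ (k - 1) * Real.log r := by positivity
  have hcol := one_le_hyperProb_rColorable_add (r := r - 2 * t) (a := a) (m := t) (t := t)
    (b := t / k) hk hn hp0 hp1 hD0 ?_ ?_ ?_ ha0 ?_ ?_
  · rw [show r - 2 * t + (t + t) = r by omega] at hcol
    linarith
  · rw [one_le_div (by positivity)]
    linarith
  · refine le_trans ?_ hrexp
    have h1 : η * r / (2 * k) ≤ t / k := by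
      calc η * r / (2 * k) = η * r / 2 / k := by field_simp
        _ ≤ _ := by gcongr
    have h2 : Real.log r ≤ r := (Real.log_le_sub_one_of_pos hr').trans (by linarith)
    calc Real.exp (3 - t / k) * ((r : ℝ) ^ (k - 1) * Real.log r) ≤
          Real.exp (3 - η * r / (2 * k)) * ((r : ℝ) ^ (k - 1) * r) := by gcongr
      _ = _ := by rw [← pow_succ, Nat.sub_add_cancel (by omega)]
  · have hC : (0 : ℝ) < n.choose k := by exact_mod_cast Nat.choose_pos hkn
    have h1 : p * n.choose k = (1 - ε) * ((r : ℝ) ^ (k - 1) * Real.log r * n) := by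
      rw [hp]; field_simp
    rw [h1]
    exact mul_le_of_le_one_left (by positivity) (by linarith)
  · have h1 : (r : ℝ) ^ (k - 1) * Real.log r * (2 * a / n) ^ (k - 1) =
        (r * l * (2 * a / n)) ^ (k - 1) := by rw [mul_pow, mul_pow, hl]
    have h2 : r * l * (2 * a / n) ≤ 1 / 4 := by
      calc r * l * (2 * a / n) ≤ r * l * (2 * ((n : ℝ) / r / (8 * l)) / n) := by gcongr
        _ = 1 / 4 := by field_simp; norm_num
    have h3 : Real.exp 2 ≤ 8 := by
      have h4 : Real.exp 2 = Real.exp 1 ^ 2 := by rw [← Real.exp_nat_mul]; norm_num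
      have h5 := Real.exp_one_lt_d9
      rw [h4]
      calc Real.exp 1 ^ 2 ≤ (2.8 : ℝ) ^ 2 := by
            gcongr
            linarith
        _ ≤ 8 := by norm_num
    have h6 : 0 ≤ r * l * (2 * a / n) := by positivity
    calc _ = 2 * Real.exp 2 * (r * l * (2 * a / n)) ^ (k - 1) := by rw [← h1]; ring
      _ ≤ 2 * 8 * (1 / 4 : ℝ) ^ 2 := by
          gcongr
          calc (r * l * (2 * a / n)) ^ (k - 1) ≤ (1 / 4 : ℝ) ^ (k - 1) := by gcongr
            _ ≤ _ := pow_le_pow_of_le_one (by norm_num) (by norm_num) (by omega)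
      _ = 1 := by norm_num
  · rw [mul_div_cancel₀ _ (by positivity)]

end Core

section Limit

lemma exists_pow_one_add_mul_le (k : ℕ) {ε : ℝ} (hε : 0 < ε) :
    ∃ ζ : ℝ, 0 < ζ ∧ ζ ≤ 1 ∧ (1 + ζ) ^ k * (1 - ε) ≤ 1 - ε / 2 := by
  have hcont : Tendsto (fun ζ : ℝ => (1 + ζ) ^ k * (1 - ε)) (nhdsWithin 0 (Set.Ioi 0))
      (nhds (1 - ε)) := by
    have h : ContinuousAt (fun ζ : ℝ => (1 + ζ) ^ k * (1 - ε)) 0 := by fun_prop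
    have h2 := h.tendsto
    simp only [add_zero, one_pow, one_mul] at h2
    exact h2.mono_left nhdsWithin_le_nhds
  have h1 := hcont.eventually_le_const (by linarith : 1 - ε < 1 - ε / 2)
  have h2 : ∀ᶠ ζ : ℝ in nhdsWithin 0 (Set.Ioi 0), ζ ∈ Set.Ioc (0 : ℝ) 1 :=
    Ioc_mem_nhdsGT one_pos
  obtain ⟨ζ, h, h'⟩ := (h1.and h2).exists
  exact ⟨ζ, h'.1, h'.2, h⟩

lemma eventually_exp_mul_pow_le {c : ℝ} (hc : 0 < c) (d : ℝ) (k : ℕ) {δ : ℝ} (hδ : 0 < δ) :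
    ∀ᶠ r : ℕ in atTop, Real.exp (d - c * r) * (r : ℝ) ^ k ≤ δ := by
  have h := (Real.tendsto_pow_mul_exp_neg_atTop_nhds_zero k).comp
    (tendsto_natCast_atTop_atTop.const_mul_atTop hc : Tendsto (fun r : ℕ => c * (r : ℝ)) _ _)
  have h2 := (h.const_mul (Real.exp d / c ^ k))
  rw [mul_zero] at h2
  filter_upwards [h2.eventually_le_const hδ] with r hr
  refine le_trans (le_of_eq ?_) hr
  simp only [Function.comp]
  rw [mul_pow, sub_eq_add_neg, Real.exp_add]
  field_simp

lemma eventually_mul_log_pow_le (C : ℝ) {ε : ℝ} (hε : 0 < ε) :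
    ∀ᶠ r : ℕ in atTop, C * Real.log r ^ 5 ≤ (r : ℝ) ^ ε := by
  have h := (isLittleO_log_rpow_rpow_atTop 5 hε).comp_tendsto tendsto_natCast_atTop_atTop
  have hC : 0 < |C| + 1 := by positivity
  filter_upwards [h.bound (inv_pos.2 hC), eventually_ge_atTop 1] with r hr hr1
  have hlog := Real.log_natCast_nonneg r
  simp only [Function.comp] at hr
  rw [Real.norm_of_nonneg (by positivity), Real.norm_of_nonneg (by positivity),
    inv_mul_eq_div, le_div_iff₀ hC] at hr
  have h5 : Real.log r ^ (5 : ℝ) = Real.log r ^ 5 := by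
    rw [← Real.rpow_natCast]; norm_num
  rw [h5] at hr
  have : 0 ≤ Real.log r ^ 5 := by positivity
  nlinarith [le_abs_self C]

lemma tendsto_mul_exp_neg_div_log {c : ℝ} (hc : 0 < c) :
    Tendsto (fun n : ℕ => (n : ℝ) * Real.exp (-(c * (n / Real.log n)))) atTop (nhds 0) := by
  have hlim : Tendsto (fun n : ℕ => 1 / (n : ℝ)) atTop (nhds 0) :=
    tendsto_one_div_atTop_nhds_zero_nat
  have hev := (isLittleO_log_rpow_rpow_atTop 2 (one_pos)).comp_tendsto
    (tendsto_natCast_atTop_atTop (R := ℝ))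
  refine tendsto_of_tendsto_of_tendsto_of_le_of_le' tendsto_const_nhds hlim
    (Eventually.of_forall fun n => by positivity) ?_
  filter_upwards [hev.bound (show 0 < c / 2 by positivity), eventually_ge_atTop 3] with n h hn
  have hn' : (0 : ℝ) < n := by exact_mod_cast (by omega : 0 < n)
  have hlog : 0 < Real.log n := Real.log_pos (by exact_mod_cast (by omega : 1 < n))
  simp only [Function.comp, Real.rpow_one] at h
  rw [Real.norm_of_nonneg (by positivity), Real.norm_of_nonneg (by positivity), Real.rpow_two] at h
  have h2 : 2 * Real.log n ≤ c * (n / Real.log n) := by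
    rw [mul_div_assoc', le_div_iff₀ hlog]
    linarith
  have h3 : Real.exp (2 * Real.log n) = (n : ℝ) * n := by
    rw [two_mul, Real.exp_add, Real.exp_log hn']
  calc (n : ℝ) * Real.exp (-(c * (n / Real.log n))) ≤ n * Real.exp (-(2 * Real.log n)) := by
        gcongr
    _ = 1 / n := by
        rw [Real.exp_neg, h3]; field_simp

lemma mul_le_div_of_pow_le {k n r : ℕ} {K l : ℝ} (hk : k ≠ 0) (hr : 0 < r) (hK : 0 < K)
    (hl : l ^ k = Real.log r)
    (h : (r : ℝ) ^ k * Real.log r ≤ (K ^ k)⁻¹ * (n : ℝ) ^ k) : K * l ≤ (n : ℝ) / r := by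
  have hr' : (0 : ℝ) < r := by exact_mod_cast hr
  rw [le_div_iff₀ hr']
  refine le_of_pow_le_pow_left₀ hk (by positivity) ?_
  rw [inv_mul_eq_div, le_div_iff₀ (by positivity), ← hl] at h
  calc (K * l * r) ^ k = (r : ℝ) ^ k * l ^ k * K ^ k := by rw [mul_pow, mul_pow]; ring
    _ ≤ _ := h

end Limit

end HG

/-- Let `k ≥ 3` and `ε ∈ (0,1)` be fixed. There is a constant
`r₀ = r₀(k,ε)` such that for any function `r = r(n)` satisfying `r ≥ r₀` and
`r^(k−1) ln r = o(n^(k−1))`, one has `P(χ(H(n,k,p)) ≤ r) → 1` as `n → ∞`, where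
`p = (1−ε) r^(k−1) (ln r) n / C(n,k)`. -/
theorem stmt18 (k : ℕ) (hk : 3 ≤ k) (ε : ℝ) (hε : ε ∈ Set.Ioo (0 : ℝ) 1) :
    ∃ r₀ : ℕ, ∀ r : ℕ → ℕ,
      (∀ n, r₀ ≤ r n) →
      ((fun n => (r n : ℝ) ^ (k - 1) * Real.log (r n)) =o[atTop]
        fun n => (n : ℝ) ^ (k - 1)) →
      Tendsto (fun n => HG.hyperProb n k
          ((1 - ε) * (r n : ℝ) ^ (k - 1) * Real.log (r n) *
            ((n : ℝ) / (n.choose k : ℝ)))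
          (HG.RColorable (r n))) atTop (nhds 1) := by
  obtain ⟨hε0, hε1⟩ := hε
  obtain ⟨ζ, hζ0, hζ1, hεζ⟩ := HG.exists_pow_one_add_mul_le k hε0
  obtain ⟨η, hη⟩ : ∃ η, η = ζ / 8 := ⟨_, rfl⟩
  have hη0 : 0 < η := by rw [hη]; positivity
  have hk0 : (0 : ℝ) < k := by exact_mod_cast (by omega : 0 < k)
  set X := ⌈16 / ε⌉₊ with hXdef
  have hX : 0 < X := Nat.ceil_pos.2 (by positivity)
  have hXε : 16 ≤ ε * X := by
    have := Nat.le_ceil (16 / ε)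
    rwa [← hXdef, div_le_iff₀ hε0, mul_comm] at this
  obtain ⟨K, hK⟩ : ∃ K : ℝ, K = 256 / η ^ 2 + 2 / ζ + (X : ℝ) ^ k + 2 * (k : ℝ) ^ k / ζ + k :=
    ⟨_, rfl⟩
  have hKη : 0 < 256 / η ^ 2 := by positivity
  have hKζ : 0 < 2 / ζ := by positivity
  have hKX : 0 < (X : ℝ) ^ k := by positivity
  have hKk : 0 < 2 * (k : ℝ) ^ k / ζ := by positivity
  have hK1 : 1 ≤ K := by
    have : (1 : ℝ) ≤ k := by exact_mod_cast (by omega : 1 ≤ k)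
    linarith
  have hlarge : ∀ᶠ r : ℕ in atTop, 1 ≤ Real.log r ∧ 2 * k ≤ η * r ∧
      Real.exp (3 - η * r / (2 * k)) * (r : ℝ) ^ k ≤ 1 / 4 ∧
      2 ^ 38 * (X : ℝ) ^ 2 / η ^ 4 * Real.log r ^ 5 ≤ (r : ℝ) ^ (ε / 4) := by
    refine ((Real.tendsto_log_atTop.comp tendsto_natCast_atTop_atTop).eventually_ge_atTop 1).and
      (((tendsto_natCast_atTop_atTop.const_mul_atTop hη0).eventually_ge_atTop _).and
      (Eventually.and ?_ (HG.eventually_mul_log_pow_le _ (by positivity))))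
    filter_upwards [HG.eventually_exp_mul_pow_le (show 0 < η / (2 * k) by positivity) 3 k
      (show (0 : ℝ) < 1 / 4 by norm_num)] with r hr
    rwa [div_mul_eq_mul_div] at hr
  obtain ⟨r₀, hr₀⟩ := eventually_atTop.1 hlarge
  refine ⟨r₀, fun r hr ho => ?_⟩
  have hlim : Tendsto (fun n : ℕ => 1 - (1 / (n : ℝ) + 4 * Real.exp 1 *
      (n * Real.exp (-(η ^ 2 / 2 ^ 15 * (n / Real.log n)))))) atTop (nhds 1) := by
    have h := tendsto_const_nhds (x := (1 : ℝ)).sub ((tendsto_one_div_atTop_nhds_zero_nat).add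
      ((HG.tendsto_mul_exp_neg_div_log (show 0 < η ^ 2 / 2 ^ 15 by positivity)).const_mul
        (4 * Real.exp 1)))
    simpa using h
  have hev : ∀ᶠ n in atTop, 0 < r n ∧ ∃ l : ℝ, 1 ≤ l ∧ l ^ (k - 1) = Real.log (r n) ∧
      K * l ≤ (n : ℝ) / r n := by
    filter_upwards [ho.bound (show 0 < (K ^ (k - 1))⁻¹ by positivity)] with n hn
    have hlog := (hr₀ (r n) (hr n)).1
    have hrn : 0 < r n := by
      rcases Nat.eq_zero_or_pos (r n) with h | h
      · rw [h] at hlog; norm_num at hlog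
      · exact h
    have hl : (Real.log (r n) ^ (((k - 1 : ℕ) : ℝ)⁻¹)) ^ (k - 1) = Real.log (r n) :=
      Real.rpow_inv_natCast_pow (by linarith) (by omega)
    refine ⟨hrn, _, Real.one_le_rpow hlog (by positivity), hl, ?_⟩
    rw [Real.norm_of_nonneg (by positivity), Real.norm_of_nonneg (by positivity)] at hn
    exact HG.mul_le_div_of_pow_le (by omega) hrn (by linarith) hl hn
  refine tendsto_of_tendsto_of_tendsto_of_le_of_le' hlim tendsto_const_nhds ?_ ?_
  · filter_upwards [hev] with n hn
    obtain ⟨hrn, l, hl1, hl, hs⟩ := hn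
    obtain ⟨-, hrk, hrexp, hrl⟩ := hr₀ (r n) (hr n)
    have hl0 : 0 < l := by linarith
    have hllog : l ≤ Real.log (r n) := by rw [← hl]; exact le_self_pow₀ hl1 (by omega)
    have hmain := HG.one_le_hyperProb_rColorable_of_params hk hε0 hε1 hζ0 hζ1 hη hεζ hX hXε hl1 hl
      (by linarith) (by linarith) (by linarith) (by linarith) (by linarith) hs hrk hrexp
      (hrl.trans' (by gcongr))
    have hrn' : (0 : ℝ) < r n := by exact_mod_cast hrn
    have hrle : (r n : ℝ) ≤ n := by
      have h1 : 1 ≤ K * l := one_le_mul_of_one_le_of_one_le hK1 hl1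
      rw [← one_le_div hrn']
      linarith
    have hl2 : l ^ 2 ≤ Real.log n := by
      calc l ^ 2 ≤ l ^ (k - 1) := pow_le_pow_right₀ hl1 (by omega)
        _ = Real.log (r n) := hl
        _ ≤ _ := Real.log_le_log hrn' hrle
    have hexp : 4 * Real.exp 1 * n * Real.exp (-(η ^ 2 / 2 ^ 15 * (n / l ^ 2))) ≤
        4 * Real.exp 1 * (n * Real.exp (-(η ^ 2 / 2 ^ 15 * (n / Real.log n)))) := by
      rw [mul_assoc _ (n : ℝ)]
      gcongr
    linarith
  · filter_upwards [hev] with n hn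
    obtain ⟨hrn, l, hl1, hl, hs⟩ := hn
    have hkn : k ≤ n := HG.le_of_mul_le_div hrn hl1 (by linarith) hs
    exact HG.hyperProb_le_one (HG.edgeProb_nonneg hε1) (HG.edgeProb_le_one (by omega) hkn hrn hε0
      hζ0 hζ1 hl (by linarith) hK1 (by linarith) hs) _
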